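/- The set of pairs (α, β) of real numbers satisfying liminf_{q→∞} q·(log q)²·‖qα‖·‖qβ‖ > 0 has Hausdorff dimension 2 in ℝ². -/

import Mathlib

open Filter

noncomputable def nint (y : ℝ) : ℝ := |y - round y|

namespace Lit
section
open MeasureTheory Set


lemma nint_le (y : ℝ) (p : ℤ) : nint y ≤ |y - p| := round_le y p

lemma nint_nonneg (y : ℝ) : 0 ≤ nint y := abs_nonneg _

lemma nint_le_half (y : ℝ) : nint y ≤ 1 / 2 := abs_sub_round y

lemma nint_le_add (y z : ℝ) : nint y ≤ nint z + |y - z| := by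
  have h1 := nint_le y (round z)
  have h2 : |y - round z| ≤ |y - z| + |z - round z| := abs_sub_le _ _ _
  unfold nint at *
  linarith

/-- The bisection step. -/
lemma bisect_step (ν : Measure ℝ) (x h : ℝ) (hh : 0 < h) (A : ENNReal)
    (hA : ν (Ico x (x + h)) ≤ A) :
    ∃ y, (y = x ∨ y = x + h / 2) ∧ ν (Ico y (y + h / 2)) ≤ A * 2⁻¹ := by
  have hun : Ico x (x + h) = Ico x (x + h / 2) ∪ Ico (x + h / 2) (x + h / 2 + h / 2) := by
    rw [Ico_union_Ico_eq_Ico] <;> first | linarith | skip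
    congr 1; ring
  have hdis : Disjoint (Ico x (x + h / 2)) (Ico (x + h / 2) (x + h / 2 + h / 2)) := by
    rw [Set.disjoint_left]
    intro z hz hz'
    exact absurd hz.2 (not_lt.mpr hz'.1)
  rw [hun, measure_union hdis measurableSet_Ico] at hA
  by_contra hcon
  push Not at hcon
  have h1 := hcon x (Or.inl rfl)
  have h2 := hcon (x + h / 2) (Or.inr rfl)
  have : A * 2⁻¹ + A * 2⁻¹ < A := by
    calc _ < _ := ENNReal.add_lt_add h1 h2
      _ ≤ A := hA
  rw [← mul_add, ENNReal.inv_two_add_inv_two, mul_one] at this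
  exact lt_irrefl _ this

lemma bisect (ν : ℕ → Measure ℝ) (c : ℕ → ENNReal)
    (hν : ∀ k x, ν k (Ico x (x + (1 / 2 : ℝ) ^ k)) ≤ c k * 2⁻¹ ^ k) :
    ∃ β : ℝ, ∀ n, ∃ x, β ∈ Icc x (x + (1 / 2 : ℝ) ^ n) ∧
      ∑ k ∈ Finset.range (n + 1), ν k (Ico x (x + (1 / 2 : ℝ) ^ n))
        ≤ (∑ k ∈ Finset.range (n + 1), c k) * 2⁻¹ ^ n := by
  classical
  let P : ℕ → ℝ → Prop := fun n x =>
    ∑ k ∈ Finset.range (n + 1), ν k (Ico x (x + (1 / 2 : ℝ) ^ n))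
        ≤ (∑ k ∈ Finset.range (n + 1), c k) * 2⁻¹ ^ n
  have step : ∀ n x, P n x → ∃ y, (y = x ∨ y = x + (1 / 2 : ℝ) ^ n / 2) ∧ P (n + 1) y := by
    intro n x hx
    have hx' : (∑ k ∈ Finset.range (n + 1), ν k) (Ico x (x + (1 / 2 : ℝ) ^ n))
        ≤ (∑ k ∈ Finset.range (n + 1), c k) * 2⁻¹ ^ n := by
      rw [Measure.finsetSum_apply]; exact hx
    obtain ⟨y, hy, hy2⟩ := bisect_step _ x _ (by positivity) _ hx'
    refine ⟨y, hy, ?_⟩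
    have e : (1 / 2 : ℝ) ^ (n + 1) = (1 / 2 : ℝ) ^ n / 2 := by rw [pow_succ]; ring
    show ∑ k ∈ Finset.range (n + 1 + 1), ν k (Ico y (y + (1 / 2 : ℝ) ^ (n + 1))) ≤ _
    rw [Finset.sum_range_succ, Finset.sum_range_succ (f := c), add_mul]
    refine add_le_add ?_ (hν _ _)
    rw [Measure.finsetSum_apply] at hy2
    rw [e, pow_succ, ← mul_assoc]
    exact hy2
  have h0 : P 0 0 := by
    have := hν 0 0
    simpa [P] using this
  let X : ∀ n, {x // P n x} := fun n => Nat.rec ⟨0, h0⟩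
    (fun n x => ⟨Classical.choose (step n x.1 x.2), (Classical.choose_spec (step n x.1 x.2)).2⟩) n
  have hX : ∀ n, (X (n + 1)).1 = (X n).1 ∨ (X (n + 1)).1 = (X n).1 + (1 / 2 : ℝ) ^ n / 2 := fun n =>
    (Classical.choose_spec (step n (X n).1 (X n).2)).1
  have hanti : Antitone fun n => Icc (X n).1 ((X n).1 + (1 / 2 : ℝ) ^ n) := by
    apply antitone_nat_of_succ_le
    intro n
    have e : (1 / 2 : ℝ) ^ (n + 1) = (1 / 2 : ℝ) ^ n / 2 := by rw [pow_succ]; ring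
    have hp : (0 : ℝ) < (1 / 2 : ℝ) ^ n := by positivity
    apply Icc_subset_Icc
    · rcases hX n with h | h <;> rw [h] <;> linarith
    · rw [e]; rcases hX n with h | h <;> rw [h] <;> linarith
  have := ciSup_mem_iInter_Icc_of_antitone_Icc hanti (fun n => by simp)
  refine ⟨⨆ n, (X n).1, fun n => ⟨(X n).1, ?_, (X n).2⟩⟩
  · exact mem_iInter.mp this n

/-- Measure of the set where `q β` is close to an integer, on a short interval. -/
lemma vol_close (q k : ℕ) (h1 : 2 ^ k ≤ q) (h2 : q < 2 ^ (k + 1)) (ρ x : ℝ) (hρ : 0 ≤ ρ) :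
    volume ({b : ℝ | nint (q * b) < ρ} ∩ Ico x (x + (1 / 2 : ℝ) ^ k)) ≤
      ENNReal.ofReal (8 * ρ / 2 ^ k) := by
  have hq0 : (0 : ℝ) < q := by
    have : 0 < q := lt_of_lt_of_le (by positivity) h1
    exact_mod_cast this
  have hq1 : (2 : ℝ) ^ k ≤ q := by exact_mod_cast h1
  have hq2 : (q : ℝ) < 2 * 2 ^ k := by
    have : (q : ℝ) < 2 ^ (k + 1) := by exact_mod_cast h2
    rw [pow_succ] at this; linarith
  have hsub : ({b : ℝ | nint (q * b) < ρ} ∩ Ico x (x + (1 / 2 : ℝ) ^ k)) ⊆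
      ⋃ i ∈ Finset.range 4, Icc (((⌊q * x⌋ + (i : ℤ) : ℤ) : ℝ) / q - ρ / q)
        (((⌊q * x⌋ + (i : ℤ) : ℤ) : ℝ) / q + ρ / q) := by
    rintro b ⟨hb, hbx⟩
    have hb' : |q * b - round (q * b)| < ρ := hb
    have e1 : (q : ℝ) * x ≤ q * b := by gcongr; exact hbx.1
    have e2 : (q : ℝ) * b < q * x + 2 := by
      have : (q : ℝ) * b < q * (x + (1 / 2 : ℝ) ^ k) := by gcongr; exact hbx.2
      have h3 : (q : ℝ) * (1 / 2) ^ k < 2 := by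
        rw [one_div, inv_pow, ← div_eq_mul_inv, div_lt_iff₀ (by positivity)]; exact hq2
      linarith
    have f1 : ⌊(q : ℝ) * x⌋ ≤ round ((q : ℝ) * b) := by
      rw [round_eq]; apply Int.floor_le_floor; linarith
    have f2 : round ((q : ℝ) * b) < ⌊(q : ℝ) * x⌋ + 4 := by
      rw [round_eq, Int.floor_lt]
      push_cast
      have := Int.lt_floor_add_one ((q : ℝ) * x)
      linarith
    simp only [mem_iUnion]
    refine ⟨(round ((q : ℝ) * b) - ⌊(q : ℝ) * x⌋).toNat, ?_, ?_⟩
    · simp only [Finset.mem_range]; omega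
    · have : (⌊(q : ℝ) * x⌋ + (((round ((q : ℝ) * b) - ⌊(q : ℝ) * x⌋).toNat : ℕ) : ℤ) : ℤ)
          = round ((q : ℝ) * b) := by omega
      rw [this]
      rw [abs_lt] at hb'
      constructor
      · rw [← sub_div, div_le_iff₀ hq0]; nlinarith
      · rw [← add_div, le_div_iff₀ hq0]; nlinarith
  refine (measure_mono hsub).trans ((measure_biUnion_finset_le _ _).trans ?_)
  simp only [Real.volume_Icc]
  calc _ ≤ ∑ i ∈ Finset.range 4, ENNReal.ofReal (2 * ρ / 2 ^ k) := by
        apply Finset.sum_le_sum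
        intro i _
        apply ENNReal.ofReal_le_ofReal
        have : ρ / q ≤ ρ / 2 ^ k := by gcongr
        have e : 2 * ρ / 2 ^ k = 2 * (ρ / 2 ^ k) := by ring
        rw [e]; linarith
    _ = ENNReal.ofReal (8 * ρ / 2 ^ k) := by
        rw [Finset.sum_const, Finset.card_range, nsmul_eq_mul,
          show ((4 : ℕ) : ENNReal) = ENNReal.ofReal 4 by simp, ← ENNReal.ofReal_mul (by norm_num)]
        congr 1; ring


end
end Lit

namespace Lit
section
open MeasureTheory Set


structure Nice (C α : ℝ) : Prop where
  pos : ∀ q : ℕ, 1 ≤ q → 0 < nint (q * α)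
  sum : ∀ N : ℕ, ∑ k ∈ Finset.Icc 1 N,
    (∑ q ∈ Finset.Ico (2 ^ k) (2 ^ (k + 1)), 1 / nint ((q : ℕ) * α)) / (2 ^ k * k) ≤ C * N
  freq : ∃ᶠ q : ℕ in atTop, q * Real.log q ^ 2 * nint (q * α) ≤ C

lemma exists_level (t : ℝ) (ht1 : t < 1) : ∃ Ct : ℝ, 0 < Ct ∧ ∀ ρ : ℝ, 0 < ρ → ρ ≤ 1 →
    ∃ m : ℕ, 1 ≤ m ∧ (1 / 2 : ℝ) ^ m ≤ ρ ∧ m * (4 * ρ) ≤ Ct * ρ ^ t := by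
  set ε := 1 - t with hε
  have hε0 : 0 < ε := by linarith
  have hl2 : 0 < Real.log 2 := Real.log_pos (by norm_num)
  refine ⟨4 * (1 / (ε * Real.log 2) + 2), by positivity, fun ρ h0 h1 => ?_⟩
  refine ⟨⌈(1 / ρ) ^ ε / (ε * Real.log 2)⌉₊ + 1, by omega, ?_, ?_⟩
  · set m := ⌈(1 / ρ) ^ ε / (ε * Real.log 2)⌉₊ + 1 with hm
    have hm1 : (1 / ρ) ^ ε / (ε * Real.log 2) ≤ m := by
      rw [hm]; push_cast
      have := Nat.le_ceil ((1 / ρ) ^ ε / (ε * Real.log 2)); linarith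
    have h2 := Real.log_le_rpow_div (x := 1 / ρ) (by positivity) hε0
    have h3 : Real.log (1 / ρ) ≤ m * Real.log 2 := by
      refine h2.trans ?_
      rw [div_le_iff₀ (by positivity)] at hm1
      rw [div_le_iff₀ hε0]; linarith
    have h4 : 1 / ρ ≤ 2 ^ m := by
      rw [← Real.log_le_log_iff (by positivity) (by positivity), Real.log_pow]; exact h3
    rw [one_div, inv_pow, inv_le_comm₀ (by positivity) h0, ← one_div]; exact h4
  · push_cast
    have h2 : (⌈(1 / ρ) ^ ε / (ε * Real.log 2)⌉₊ : ℝ) < (1 / ρ) ^ ε / (ε * Real.log 2) + 1 :=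
      Nat.ceil_lt_add_one (by positivity)
    have h3 : (1 / ρ) ^ ε * ρ = ρ ^ t := by
      rw [one_div, Real.inv_rpow h0.le, ← Real.rpow_neg h0.le]
      nth_rewrite 2 [← Real.rpow_one ρ]
      rw [← Real.rpow_add h0]; congr 1; rw [hε]; ring
    have h4 : ρ ≤ ρ ^ t := by
      nth_rewrite 1 [← Real.rpow_one ρ]
      exact Real.rpow_le_rpow_of_exponent_ge h0 h1 ht1.le
    calc _ ≤ ((1 / ρ) ^ ε / (ε * Real.log 2) + 2) * (4 * ρ) := by
          apply mul_le_mul_of_nonneg_right (by linarith) (by positivity)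
      _ = 4 * (((1 / ρ) ^ ε * ρ) / (ε * Real.log 2) + 2 * ρ) := by ring
      _ ≤ 4 * (ρ ^ t / (ε * Real.log 2) + 2 * ρ ^ t) := by rw [h3]; gcongr
      _ = _ := by ring

lemma exists_k0 (c : ℝ) (hc : 0 < c) : ∃ k0 : ℕ, 1 ≤ k0 ∧ ∀ k : ℕ, k0 ≤ k → (k : ℝ) ^ 2 ≤ c * 2 ^ k := by
  have h := tendsto_pow_const_div_const_pow_of_one_lt 2 (r := (2 : ℝ)) (by norm_num)
  have h2 := (h.eventually (gt_mem_nhds hc))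
  rw [eventually_atTop] at h2
  obtain ⟨a, ha⟩ := h2
  refine ⟨a + 1, by omega, fun k hk => ?_⟩
  have := ha k (by omega)
  rw [div_lt_iff₀ (by positivity)] at this
  exact this.le

theorem beta_exists (C t : ℝ) (hC : 0 < C) (ht1 : t < 1) :
    ∃ ε : ENNReal, 0 < ε ∧ ∀ α, Nice C α → ∀ (V : ℕ → Set ℝ) (ρ : ℕ → ℝ),
      (∀ i, 0 < ρ i) → (∀ i, ρ i ≤ 1) → (∀ i, ∀ y ∈ V i, ∀ z ∈ V i, |y - z| ≤ ρ i) →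
      (∑' i, (⨆ _ : (V i).Nonempty, ENNReal.ofReal (ρ i ^ t))) ≤ ε →
      ∃ β, (∀ i, β ∉ V i) ∧ ∃ c : ℝ, 0 < c ∧
        ∀ᶠ q : ℕ in atTop, c ≤ q * Real.log q ^ 2 * nint (q * α) * nint (q * β) := by
  classical
  obtain ⟨Ct, hCt, hlev⟩ := exists_level t ht1
  set c : ℝ := 1 / (96 * C) with hc
  have hc0 : 0 < c := by positivity
  obtain ⟨k0, hk01, hk0⟩ := exists_k0 c hc0
  refine ⟨ENNReal.ofReal (1 / (4 * Ct)), by simp; positivity, ?_⟩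
  intro α hα V ρ hρ0 hρ1 hV hsum
  choose m hm1 hm2 hm3 using fun i => hlev (ρ i) (hρ0 i) (hρ1 i)
  -- thickened cover
  let y : ℕ → ℝ := fun i => if h : (V i).Nonempty then h.some else 0
  have hy : ∀ i, ∀ z ∈ V i, |z - y i| ≤ ρ i := by
    intro i z hz
    have hne : (V i).Nonempty := ⟨z, hz⟩
    simp only [y, hne, dif_pos]
    exact hV i z hz _ hne.some_mem
  let W : ℕ → Set ℝ := fun i => if (V i).Nonempty then Icc (y i - 2 * ρ i) (y i + 2 * ρ i) else ∅
  let ν0 : Measure ℝ := Measure.sum fun i => (m i : ENNReal) • volume.restrict (W i)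
  let rad : ℕ → ℕ → ℝ := fun k q => 2 * c / (2 ^ k * k ^ 2 * nint (q * α))
  let E : ℕ → ℕ → Set ℝ := fun k q => {b : ℝ | nint (q * b) < rad k q}
  let ν : ℕ → Measure ℝ := fun k => if k = 0 then ν0 else if k < k0 then 0 else
    ∑ q ∈ Finset.Ico (2 ^ k) (2 ^ (k + 1)), ((3 * k : ℕ) : ENNReal) • volume.restrict (E k q)
  let B : ℕ → ℝ := fun k =>
    (∑ q ∈ Finset.Ico (2 ^ k) (2 ^ (k + 1)), 1 / nint ((q : ℕ) * α)) / (2 ^ k * k)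
  have hB0 : ∀ k, 0 ≤ B k := fun k => by
    apply div_nonneg _ (by positivity)
    exact Finset.sum_nonneg fun q _ => div_nonneg zero_le_one (nint_nonneg _)
  let cc : ℕ → ENNReal := fun k => if k = 0 then ENNReal.ofReal (1 / 4) else ENNReal.ofReal (48 * c * B k)
  have hν0 : ν0 univ ≤ ENNReal.ofReal (1 / 4) := by
    rw [Measure.sum_apply _ MeasurableSet.univ]
    calc _ ≤ ∑' i, ENNReal.ofReal Ct * (⨆ _ : (V i).Nonempty, ENNReal.ofReal (ρ i ^ t)) := by
          apply ENNReal.tsum_le_tsum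
          intro i
          simp only [Measure.smul_apply, smul_eq_mul, Measure.restrict_apply_univ]
          by_cases h : (V i).Nonempty
          · simp only [W, h, if_true, Real.volume_Icc, iSup_pos]
            rw [← ENNReal.ofReal_mul hCt.le, ← ENNReal.ofReal_natCast,
              ← ENNReal.ofReal_mul (by positivity)]
            apply ENNReal.ofReal_le_ofReal
            convert hm3 i using 2; ring
          · simp [W, h]
      _ = ENNReal.ofReal Ct * ∑' i, (⨆ _ : (V i).Nonempty, ENNReal.ofReal (ρ i ^ t)) :=
          ENNReal.tsum_mul_left
      _ ≤ ENNReal.ofReal Ct * ENNReal.ofReal (1 / (4 * Ct)) := by gcongr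
      _ = _ := by
          rw [← ENNReal.ofReal_mul hCt.le]; congr 1; field_simp
  have half : ∀ n : ℕ, (2⁻¹ : ENNReal) ^ n = ENNReal.ofReal ((1 / 2 : ℝ) ^ n) := by
    intro n
    rw [ENNReal.ofReal_pow (by norm_num)]
    congr 1
    rw [one_div, ENNReal.ofReal_inv_of_pos (by norm_num)]; simp
  have hνb : ∀ k x, ν k (Ico x (x + (1 / 2 : ℝ) ^ k)) ≤ cc k * 2⁻¹ ^ k := by
    intro k x
    by_cases hk : k = 0
    · subst hk
      simp only [ν, cc, if_true, pow_zero, mul_one]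
      exact (measure_mono (subset_univ _)).trans hν0
    · simp only [ν, cc, hk, if_false]
      split_ifs with hkk
      · simp
      · rw [Measure.finsetSum_apply]
        have hkpos : (0 : ℝ) < k := by exact_mod_cast Nat.pos_of_ne_zero hk
        calc _ ≤ ∑ q ∈ Finset.Ico (2 ^ k) (2 ^ (k + 1)),
              ENNReal.ofReal ((3 * k) * (8 * rad k q / 2 ^ k)) := by
              apply Finset.sum_le_sum
              intro q hq
              rw [Finset.mem_Ico] at hq
              rw [Measure.smul_apply, smul_eq_mul, Measure.restrict_apply measurableSet_Ico,
                inter_comm, ENNReal.ofReal_mul (by positivity)]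
              have hr : 0 ≤ rad k q := div_nonneg (by positivity)
                (mul_nonneg (by positivity) (nint_nonneg _))
              have h3 : ENNReal.ofReal (3 * (k : ℝ)) = ((3 * k : ℕ) : ENNReal) := by
                rw [← ENNReal.ofReal_natCast]; push_cast; rfl
              rw [h3]
              gcongr
              exact vol_close q k hq.1 hq.2 _ x hr
          _ = ENNReal.ofReal (∑ q ∈ Finset.Ico (2 ^ k) (2 ^ (k + 1)),
                ((3 * k) * (8 * rad k q / 2 ^ k))) := by
              rw [ENNReal.ofReal_sum_of_nonneg]
              intro q _
              have hr : 0 ≤ rad k q := div_nonneg (by positivity)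
                (mul_nonneg (by positivity) (nint_nonneg _))
              positivity
          _ = _ := by
              rw [half, ← ENNReal.ofReal_mul (mul_nonneg (by positivity) (hB0 k))]
              congr 1
              simp only [B, rad]
              rw [Finset.sum_div, Finset.mul_sum, Finset.sum_mul]
              apply Finset.sum_congr rfl
              intro q hq
              rw [Finset.mem_Ico] at hq
              have := hα.pos q (le_trans Nat.one_le_two_pow hq.1)
              have e2 : (1 / 2 : ℝ) ^ k = 1 / 2 ^ k := by rw [one_div, inv_pow, one_div]
              rw [e2]
              field_simp
              norm_num
  obtain ⟨β, hβ⟩ := bisect ν cc hνb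
  have key : ∀ n : ℕ, 1 ≤ n → ∃ x, β ∈ Icc x (x + (1 / 2 : ℝ) ^ n) ∧
      ∀ j ≤ n, ν j (Ico x (x + (1 / 2 : ℝ) ^ n)) < n * ENNReal.ofReal ((1 / 2 : ℝ) ^ n) := by
    intro n hn
    obtain ⟨x, hx, hx2⟩ := hβ n
    refine ⟨x, hx, fun j hj => ?_⟩
    have h1 : ν j (Ico x (x + (1 / 2 : ℝ) ^ n)) ≤
        ∑ k ∈ Finset.range (n + 1), ν k (Ico x (x + (1 / 2 : ℝ) ^ n)) :=
      Finset.single_le_sum (f := fun k => ν k (Ico x (x + (1 / 2 : ℝ) ^ n)))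
        (fun _ _ => zero_le) (Finset.mem_range.mpr (by omega))
    refine lt_of_le_of_lt (h1.trans hx2) ?_
    rw [half]
    have hcs : ∑ k ∈ Finset.range (n + 1), cc k ≤ ENNReal.ofReal (1 / 4 + n / 2) := by
      rw [Finset.sum_range_succ', ENNReal.ofReal_add (by norm_num) (by positivity), add_comm]
      apply add_le_add
      · simp [cc]
      · have e : ∀ k ∈ Finset.range n, cc (k + 1) = ENNReal.ofReal (48 * c * B (k + 1)) := by
          intro k _; simp [cc]
        rw [Finset.sum_congr rfl e, ← ENNReal.ofReal_sum_of_nonneg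
          (fun k _ => mul_nonneg (by positivity) (hB0 _))]
        apply ENNReal.ofReal_le_ofReal
        rw [← Finset.mul_sum]
        have e2 : ∑ k ∈ Finset.range n, B (k + 1) = ∑ k ∈ Finset.Icc 1 n, B k := by
          rw [Finset.range_eq_Ico, Finset.sum_Ico_add' B 0 n 1]
          rfl
        have := hα.sum n
        rw [e2]
        calc 48 * c * ∑ k ∈ Finset.Icc 1 n, B k ≤ 48 * c * (C * n) := by
              gcongr
          _ = n / 2 := by rw [hc]; field_simp; norm_num
          _ ≤ _ := le_rfl
    have hn' : (1 : ℝ) ≤ n := by exact_mod_cast hn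
    calc _ ≤ ENNReal.ofReal (1 / 4 + n / 2) * ENNReal.ofReal ((1 / 2 : ℝ) ^ n) := by gcongr
      _ < _ := by
        rw [← ENNReal.ofReal_natCast, ← ENNReal.ofReal_mul (by positivity),
          ← ENNReal.ofReal_mul (by positivity)]
        rw [ENNReal.ofReal_lt_ofReal_iff (by positivity)]
        gcongr
        linarith
  refine ⟨β, ?_, c * Real.log 2 ^ 2, by have := Real.log_pos (one_lt_two); positivity, ?_⟩
  · intro i hi
    obtain ⟨x, hx, hx2⟩ := key (m i) (hm1 i)
    have h := hx2 0 (Nat.zero_le _)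
    simp only [ν, if_true] at h
    refine absurd h (not_lt.mpr ?_)
    refine le_trans ?_ (Measure.le_sum_apply _ _)
    refine le_trans ?_ (ENNReal.le_tsum i)
    rw [Measure.smul_apply, smul_eq_mul, Measure.restrict_apply measurableSet_Ico]
    have hsub : Ico x (x + (1 / 2 : ℝ) ^ m i) ⊆ W i := by
      intro z hz
      have hne : (V i).Nonempty := ⟨β, hi⟩
      simp only [W, hne, if_true]
      have h1 := abs_le.mp (hy i β hi)
      have h2 := hm2 i
      constructor
      · linarith [h1.1, hz.1, hx.2]
      · linarith [h1.2, hz.2, hx.1]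
    rw [inter_eq_left.mpr hsub, Real.volume_Ico]
    simp
  · filter_upwards [eventually_ge_atTop (2 ^ k0)] with q hq
    set k := Nat.log 2 q with hk
    have hq0 : q ≠ 0 := by
      have : 0 < 2 ^ k0 := by positivity
      omega
    have hk1 : 2 ^ k ≤ q := Nat.pow_log_le_self 2 hq0
    have hk2 : q < 2 ^ (k + 1) := Nat.lt_pow_succ_log_self (by norm_num) q
    have hkk0 : k0 ≤ k := Nat.le_log_of_pow_le (by norm_num) hq
    have hkpos : (1 : ℝ) ≤ k := by exact_mod_cast (le_trans hk01 hkk0)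
    have hqr1 : (2 : ℝ) ^ k ≤ q := by exact_mod_cast hk1
    have hqr2 : (q : ℝ) ≤ 2 * 2 ^ k := by
      have : (q : ℝ) < 2 ^ (k + 1) := by exact_mod_cast hk2
      rw [pow_succ] at this; linarith
    have hna := hα.pos q (by omega)
    have main : rad k q / 2 ≤ nint (q * β) := by
      by_contra hcon
      push Not at hcon
      obtain ⟨x, hx, hx2⟩ := key (3 * k) (by omega)
      have h := hx2 k (by omega)
      have hk0' : k ≠ 0 := by omega
      simp only [ν, hk0', if_false, not_lt.mpr hkk0] at h
      refine absurd h (not_lt.mpr ?_)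
      rw [Measure.finsetSum_apply]
      refine le_trans ?_ (Finset.single_le_sum
        (f := fun q : ℕ => (((3 * k : ℕ) : ENNReal) • volume.restrict (E k q)) (Ico x (x + (1 / 2) ^ (3 * k))))
        (fun _ _ => zero_le) (Finset.mem_Ico.mpr ⟨hk1, hk2⟩))
      simp only [Measure.smul_apply, smul_eq_mul, Measure.restrict_apply measurableSet_Ico]
      have hthick : (q : ℝ) * (1 / 2) ^ (3 * k) ≤ rad k q / 2 := by
        have h1 := hk0 k hkk0
        have h2 : (1 / 2 : ℝ) ^ (3 * k) = 1 / (2 ^ k * 2 ^ k * 2 ^ k) := by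
          rw [one_div, inv_pow, one_div, mul_comm, pow_mul]; ring
        have h3 := nint_le_half ((q : ℝ) * α)
        calc (q : ℝ) * (1 / 2) ^ (3 * k) ≤ (2 * 2 ^ k) * (1 / 2) ^ (3 * k) := by gcongr
          _ = 2 / (2 ^ k * 2 ^ k) := by rw [h2]; field_simp
          _ ≤ c / (2 ^ k * k ^ 2 * (1 / 2)) := by
              rw [div_le_div_iff₀ (by positivity) (by positivity)]
              have : (0 : ℝ) < 2 ^ k := by positivity
              nlinarith
          _ ≤ c / (2 ^ k * k ^ 2 * nint (q * α)) := by gcongr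
          _ = rad k q / 2 := by simp only [rad]; ring
      have hsub : Ico x (x + (1 / 2 : ℝ) ^ (3 * k)) ⊆ E k q := by
        intro z hz
        show nint (q * z) < rad k q
        have h1 := nint_le_add (q * z) (q * β)
        have h2 : |(q : ℝ) * z - q * β| ≤ q * (1 / 2) ^ (3 * k) := by
          rw [← mul_sub, abs_mul, abs_of_nonneg (by positivity : (0 : ℝ) ≤ q)]
          gcongr
          rw [abs_le]; constructor
          · linarith [hz.1, hx.2]
          · linarith [hz.2, hx.1]
        linarith
      rw [inter_eq_left.mpr hsub, Real.volume_Ico]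
      simp
    have hlog : (k : ℝ) * Real.log 2 ≤ Real.log q := by
      rw [← Real.log_pow]; exact Real.log_le_log (by positivity) hqr1
    have hl2 := Real.log_pos (one_lt_two)
    calc c * Real.log 2 ^ 2 = 2 ^ k * (k * Real.log 2) ^ 2 * nint (q * α) * (rad k q / 2) := by
          simp only [rad]; field_simp
      _ ≤ _ := by gcongr


end
end Lit

namespace Lit
section
open MeasureTheory Set


open Classical in
/-- weight of the sets of the family `A` meeting `I`. -/
noncomputable def meets (A : ℕ → Set ℝ) (w : ℕ → ENNReal) (I : Set ℝ) : ENNReal :=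
  ∑' i, if (A i ∩ I).Nonempty then w i else 0

lemma greedy (r : ℕ → ℝ) (G : ℕ → ℝ → Prop) (lam : ℕ → ENNReal)
    (hr0 : ∀ n, 0 ≤ r n) (hanti : Antitone r) (x0 : ℝ) (hG0 : G 0 x0)
    (step : ∀ n x, G n x → ∀ (A : ℕ → Set ℝ) (w : ℕ → ENNReal),
      (∀ i, ∀ y ∈ A i, ∀ z ∈ A i, |y - z| ≤ r (n + 1)) →
      ∃ x', G (n + 1) x' ∧ Icc x' (x' + r (n + 1)) ⊆ Icc x (x + r n) ∧
        meets A w (Icc x' (x' + r (n + 1))) ≤ lam n * meets A w (Icc x (x + r n)))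
    (U : ℕ → Set ℝ) (ρ : ℕ → ℝ) (hU : ∀ i, ∀ y ∈ U i, ∀ z ∈ U i, |y - z| ≤ ρ i)
    (m : ℕ → ℕ) (hm : ∀ i, ρ i ≤ r (m i)) (v : ℕ → ENNReal) :
    ∃ α, (∀ n, ∃ x, G n x ∧ α ∈ Icc x (x + r n)) ∧
      ∑' i, (U i).indicator (fun _ => v i) α ≤ ∑' i, v i * ∏ l ∈ Finset.range (m i), lam l := by
  classical
  let κ : ℕ → ℕ → ENNReal := fun n m => ∏ l ∈ Finset.Ico n m, lam l
  let Ψ : ℕ → ℝ → ENNReal := fun n x => meets U (fun i => v i * κ n (m i)) (Icc x (x + r n))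
  have hstep : ∀ n x, G n x → ∃ x', G (n + 1) x' ∧
      Icc x' (x' + r (n + 1)) ⊆ Icc x (x + r n) ∧ Ψ (n + 1) x' ≤ Ψ n x := by
    intro n x hx
    obtain ⟨x', h1, h2, h3⟩ := step n x hx (fun i => if n < m i then U i else ∅)
      (fun i => v i * κ (n + 1) (m i)) (by
        intro i y hy z hz
        split_ifs at hy hz with h
        · exact (hU i y hy z hz).trans ((hm i).trans (hanti h))
        · exact absurd hy (by simp))
    refine ⟨x', h1, h2, ?_⟩
    have split : ∀ (n' : ℕ) (I : Set ℝ), meets U (fun i => v i * κ n' (m i)) I =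
        meets (fun i => if n < m i then U i else ∅) (fun i => v i * κ n' (m i)) I +
        meets (fun i => if n < m i then ∅ else U i) (fun i => v i * κ n' (m i)) I := by
      intro n' I
      unfold meets
      rw [← ENNReal.tsum_add]
      congr 1; ext i
      by_cases h : n < m i <;> simp [h]
    simp only [Ψ]
    rw [split, split n]
    apply add_le_add
    · refine h3.trans (le_of_eq ?_)
      unfold meets
      rw [← ENNReal.tsum_mul_left]
      congr 1; ext i
      by_cases h : n < m i
      · simp only [h, if_true, mul_ite, mul_zero]
        congr 1
        simp only [κ]
        rw [Finset.prod_eq_prod_Ico_succ_bot h]; ring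
      · simp [h]
    · unfold meets
      apply ENNReal.tsum_le_tsum
      intro i
      by_cases h : n < m i
      · simp [h]
      · simp only [h, if_false]
        have e1 : κ (n + 1) (m i) = 1 := by simp [κ, Finset.Ico_eq_empty_of_le (by omega : m i ≤ n + 1)]
        have e2 : κ n (m i) = 1 := by simp [κ, Finset.Ico_eq_empty_of_le (by omega : m i ≤ n)]
        rw [e1, e2]
        split_ifs with h4 h5 h5
        · exact le_rfl
        · exact absurd (h4.mono (inter_subset_inter_right _ h2)) h5
        · exact zero_le
        · exact le_rfl
  -- sequence
  choose! f hf1 hf2 hf3 using hstep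
  let X : ℕ → ℝ := fun n => Nat.rec x0 (fun n x => f n x) n
  have hXs : ∀ n, X (n + 1) = f n (X n) := fun n => rfl
  have hG : ∀ n, G n (X n) := by
    intro n
    induction n with
    | zero => exact hG0
    | succ n ih => rw [hXs]; exact hf1 n _ ih
  have hΨ : ∀ n, Ψ n (X n) ≤ Ψ 0 x0 := by
    intro n
    induction n with
    | zero => exact le_rfl
    | succ n ih => rw [hXs]; exact (hf3 n _ (hG n)).trans ih
  have hsub : Antitone fun n => Icc (X n) (X n + r n) := by
    apply antitone_nat_of_succ_le
    intro n
    simp only [hXs]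
    exact hf2 n _ (hG n)
  have hα := ciSup_mem_iInter_Icc_of_antitone_Icc hsub (fun n => by linarith [hr0 n])
  set α := ⨆ n, X n
  rw [mem_iInter] at hα
  refine ⟨α, fun n => ⟨X n, hG n, hα n⟩, ?_⟩
  calc ∑' i, (U i).indicator (fun _ => v i) α ≤ Ψ 0 x0 := by
        rw [ENNReal.tsum_eq_iSup_sum]
        apply iSup_le
        intro s
        refine le_trans ?_ (hΨ (s.sup m))
        simp only [Ψ]
        unfold meets
        refine le_trans ?_ (ENNReal.sum_le_tsum s)
        apply Finset.sum_le_sum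
        intro i hi
        by_cases h : α ∈ U i
        · rw [indicator_of_mem h, if_pos ⟨α, h, hα _⟩]
          have : κ (s.sup m) (m i) = 1 := by
            simp [κ, Finset.Ico_eq_empty_of_le (Finset.le_sup (f := m) hi)]
          simp only [this, mul_one, le_refl]
        · rw [indicator_of_notMem h]; exact zero_le
    _ ≤ _ := by
        simp only [Ψ]
        unfold meets
        apply ENNReal.tsum_le_tsum
        intro i
        split_ifs
        · simp only [κ]
          rw [← Finset.range_eq_Ico]
        · exact zero_le

/-- averaging over grid children -/
lemma average (x h : ℝ) (hh : 0 < h) (R : ℕ) (good : Finset ℕ) (hgood : good ⊆ Finset.range R)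
    (hcard : R ≤ good.card + 3) (hR : 4 ≤ R)
    (A : ℕ → Set ℝ) (w : ℕ → ENNReal)
    (hA : ∀ i, ∀ y ∈ A i, ∀ z ∈ A i, |y - z| ≤ h) :
    ∃ j ∈ good, meets A w (Icc (x + j * h) (x + j * h + h)) ≤
      ENNReal.ofReal (3 / (R - 3)) * meets A w (Icc x (x + R * h)) := by
  classical
  set M := meets A w (Icc x (x + R * h)) with hM
  have hR' : (0 : ℝ) < R - 3 := by
    have : (4 : ℝ) ≤ R := by exact_mod_cast hR
    linarith
  have key : ∑ j ∈ good, meets A w (Icc (x + j * h) (x + j * h + h)) ≤ 3 * M := by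
    unfold meets at hM ⊢
    rw [← Summable.tsum_finsetSum (fun _ _ => ENNReal.summable), hM, ← ENNReal.tsum_mul_left]
    apply ENNReal.tsum_le_tsum
    intro i
    rw [← Finset.sum_filter, Finset.sum_const, nsmul_eq_mul]
    set s := good.filter (fun j : ℕ => (A i ∩ Icc (x + j * h) (x + j * h + h)).Nonempty) with hs
    by_cases hne : s.Nonempty
    · set j0 := s.min' hne with hj0
      have hj0s : j0 ∈ s := s.min'_mem hne
      have hsub : s ⊆ Finset.Icc j0 (j0 + 2) := by
        intro j hj
        have hle : j0 ≤ j := s.min'_le j hj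
        rw [hs, Finset.mem_filter] at hj hj0s
        obtain ⟨y, hy1, hy2⟩ := hj0s.2
        obtain ⟨z, hz1, hz2⟩ := hj.2
        have h1 := (abs_le.mp (hA i z hz1 y hy1)).2
        rw [Finset.mem_Icc]
        refine ⟨hle, ?_⟩
        have h2 : (j : ℝ) * h ≤ (j0 + 2) * h := by linarith [hz2.1, hy2.2]
        have h3 : (j : ℝ) ≤ j0 + 2 := le_of_mul_le_mul_right h2 hh
        exact_mod_cast h3
      have hc : s.card ≤ 3 := by
        refine (Finset.card_le_card hsub).trans ?_
        rw [Nat.card_Icc]; omega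
      have hmeet : (A i ∩ Icc x (x + R * h)).Nonempty := by
        rw [hs, Finset.mem_filter] at hj0s
        obtain ⟨y, hy1, hy2⟩ := hj0s.2
        have h4 := Finset.mem_range.mp (hgood hj0s.1)
        have h5 : ((j0 : ℝ) + 1) ≤ R := by exact_mod_cast h4
        refine ⟨y, hy1, ?_, ?_⟩
        · have : 0 ≤ (j0 : ℝ) * h := by positivity
          linarith [hy2.1]
        · nlinarith [hy2.2]
      rw [if_pos hmeet]
      gcongr
      exact_mod_cast hc
    · rw [Finset.not_nonempty_iff_eq_empty] at hne
      simp [hne]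
  by_contra hcon
  push Not at hcon
  have hne : good.Nonempty := by
    rw [← Finset.card_pos]; omega
  have h1 : ∑ j ∈ good, ENNReal.ofReal (3 / (R - 3)) * M <
      ∑ j ∈ good, meets A w (Icc (x + j * h) (x + j * h + h)) :=
    ENNReal.sum_lt_sum_of_nonempty hne hcon
  rw [Finset.sum_const, nsmul_eq_mul, ← mul_assoc] at h1
  have h2 : (3 : ENNReal) ≤ good.card * ENNReal.ofReal (3 / (R - 3)) := by
    rw [← ENNReal.ofReal_natCast, ← ENNReal.ofReal_mul (by positivity)]
    rw [show (3 : ENNReal) = ENNReal.ofReal 3 by simp]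
    apply ENNReal.ofReal_le_ofReal
    have : (R : ℝ) ≤ good.card + 3 := by exact_mod_cast hcard
    rw [mul_div_assoc', le_div_iff₀ hR']
    linarith
  exact absurd (lt_of_lt_of_le (lt_of_le_of_lt (mul_le_mul_left h2 M) h1) key) (lt_irrefl _)


end
end Lit

namespace Lit
section
open Set


/-- forced levels -/
def FF (n0 n : ℕ) : Prop := n0 ≤ n ∧ ∃ j : ℕ, n = 4 ^ j

open Classical in
noncomputable def ratio (R n0 l : ℕ) : ℕ := if FF n0 l then l ^ 2 else R

noncomputable def rinv (R n0 n : ℕ) : ℕ := ∏ l ∈ Finset.range n, ratio R n0 l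

structure Par (t : ℝ) (R n0 : ℕ) : Prop where
  ht0 : 0 < t
  ht1 : t < 1
  hR : 16 ≤ R
  hRt : Real.exp 1 * (R : ℝ) ^ t * 3 ≤ R - 3
  hn0 : 128 * R ^ 2 ≤ n0
  hexp : ∀ l : ℕ, n0 ≤ l → Real.exp 1 * (l : ℝ) ^ 2 ≤ Real.exp (l / 4)

lemma exists_par (t : ℝ) (ht0 : 0 < t) (ht1 : t < 1) : ∃ R n0, Par t R n0 := by
  have h1 : ∀ᶠ R : ℕ in atTop, Real.exp 1 * (R : ℝ) ^ t * 3 ≤ R - 3 := by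
    have h := (tendsto_rpow_neg_atTop (y := 1 - t) (by linarith)).eventually
      (gt_mem_nhds (show (0 : ℝ) < 1 / (6 * Real.exp 1) by positivity))
    have h2 := tendsto_natCast_atTop_atTop (R := ℝ) |>.eventually h
    filter_upwards [h2, eventually_ge_atTop 6] with R hR hR6
    have hR6' : (6 : ℝ) ≤ R := by exact_mod_cast hR6
    have hR : (R : ℝ) ^ t ≤ 1 / (6 * Real.exp 1) * R := by
      have e : (R : ℝ) ^ t = (R : ℝ) ^ (-(1 - t)) * R := by
        nth_rewrite 3 [← Real.rpow_one (R : ℝ)]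
        rw [← Real.rpow_add (by linarith)]; congr 1; ring
      rw [e]
      gcongr
    calc Real.exp 1 * (R : ℝ) ^ t * 3 ≤ Real.exp 1 * (1 / (6 * Real.exp 1) * R) * 3 := by gcongr
      _ = R / 2 := by field_simp; norm_num
      _ ≤ _ := by linarith
  obtain ⟨R, hR1, hR2⟩ := (h1.and (eventually_ge_atTop 16)).exists
  have h2 : ∀ᶠ l : ℕ in atTop, Real.exp 1 * (l : ℝ) ^ 2 ≤ Real.exp (l / 4) := by
    have h := isLittleO_pow_exp_pos_mul_atTop (b := 1/4) 2 (by norm_num)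
    have h := h.bound (show (0 : ℝ) < 1 / Real.exp 1 by positivity)
    have h2 := tendsto_natCast_atTop_atTop (R := ℝ) |>.eventually h
    filter_upwards [h2] with l hl
    rw [Real.norm_of_nonneg (by positivity), Real.norm_of_nonneg (by positivity)] at hl
    calc Real.exp 1 * (l : ℝ) ^ 2 ≤ Real.exp 1 * (1 / Real.exp 1 * Real.exp (1 / 4 * l)) := by gcongr
      _ = Real.exp (1 / 4 * l) := by field_simp
      _ = _ := by congr 1; ring
  obtain ⟨a, ha⟩ := eventually_atTop.mp h2
  exact ⟨R, max a (128 * R ^ 2), ht0, ht1, hR2, hR1, le_max_right _ _,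
    fun l hl => ha l ((le_max_left _ _).trans hl)⟩

lemma rinv_zero (R n0 : ℕ) : rinv R n0 0 = 1 := by simp [rinv]

lemma rinv_succ (R n0 n : ℕ) : rinv R n0 (n + 1) = rinv R n0 n * ratio R n0 n := by
  simp [rinv, Finset.prod_range_succ]

section
variable {t : ℝ} {R n0 : ℕ}

lemma Par.ratio_ge (P : Par t R n0) (l : ℕ) : R ≤ ratio R n0 l := by
  have := P.hR; have := P.hn0
  unfold ratio
  split_ifs with h
  · have h1 := h.1
    have h2 : R ≤ l := by nlinarith
    nlinarith
  · exact le_rfl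

lemma Par.rinv_ge (P : Par t R n0) (n : ℕ) : R ^ n ≤ rinv R n0 n := by
  induction n with
  | zero => simp [rinv]
  | succ n ih => rw [rinv_succ, pow_succ]; exact Nat.mul_le_mul ih (P.ratio_ge n)

lemma Par.rinv_pos (P : Par t R n0) (n : ℕ) : 0 < rinv R n0 n :=
  lt_of_lt_of_le (pow_pos (by have := P.hR; omega) n) (P.rinv_ge n)

lemma Par.rinv_mono (P : Par t R n0) : Monotone (rinv R n0) := by
  apply monotone_nat_of_le_succ
  intro n
  rw [rinv_succ]
  exact Nat.le_mul_of_pos_right _ (by have := P.ratio_ge n; have := P.hR; omega)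

open Classical in
lemma sum_FF (n0 n : ℕ) : 3 * ∑ l ∈ (Finset.range n).filter (FF n0), l ≤ 4 * n := by
  rcases Nat.eq_zero_or_pos n with rfl | hn
  · simp
  set J := Nat.clog 4 n with hJ
  have hsub : (Finset.range n).filter (FF n0) ⊆ (Finset.range J).image (fun j => 4 ^ j) := by
    intro l hl
    rw [Finset.mem_filter, Finset.mem_range] at hl
    obtain ⟨hl, -, j, rfl⟩ := hl
    rw [Finset.mem_image]
    refine ⟨j, ?_, rfl⟩
    rw [Finset.mem_range]
    by_contra h
    push Not at h
    have h1 : n ≤ 4 ^ J := Nat.le_pow_clog (by norm_num) n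
    have h2 : 4 ^ J ≤ 4 ^ j := Nat.pow_le_pow_right (by norm_num) h
    omega
  have h1 := Finset.sum_le_sum_of_subset (f := fun l => l) hsub
  have h2 : ∑ l ∈ (Finset.range J).image (fun j => 4 ^ j), l = ∑ j ∈ Finset.range J, 4 ^ j :=
    Finset.sum_image (fun a _ b _ hab => Nat.pow_right_injective (le_refl _ |>.trans (by norm_num)) hab)
  have h3 : ∀ J, 3 * ∑ j ∈ Finset.range J, 4 ^ j + 1 = 4 ^ J := by
    intro J
    induction J with
    | zero => simp
    | succ J ih => rw [Finset.sum_range_succ, pow_succ]; omega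
  have h4 := h3 J
  have h5 : 4 ^ J ≤ 4 * n := by
    rcases Nat.eq_zero_or_pos J with h | h
    · rw [h]; omega
    · have h6 : 4 ^ (J - 1) < n := Nat.pow_pred_clog_lt_self (by norm_num) (by
        by_contra h7
        have : n = 1 := by omega
        rw [hJ, this] at h; simp at h)
      have : 4 ^ J = 4 * 4 ^ (J - 1) := by
        rw [← pow_succ']; congr 1; omega
      omega
  rw [h2] at h1
  omega

open Classical in
lemma sum_FF' (n0 n : ℕ) : ∑ l ∈ Finset.range n, (if FF n0 l then (l : ℝ) / 4 else 0) ≤ n / 2 := by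
  have h := sum_FF n0 n
  rw [← Finset.sum_filter, ← Finset.sum_div, ← Nat.cast_sum]
  have h2 : (3 : ℝ) * ((∑ l ∈ (Finset.range n).filter (FF n0), l : ℕ) : ℝ) ≤ 4 * n := by exact_mod_cast h
  have : (0 : ℝ) ≤ n := by positivity
  linarith

lemma Par.rinv_le (P : Par t R n0) (n : ℕ) : (rinv R n0 n : ℝ) ≤ R ^ n * Real.exp (n / 2) := by
  classical
  have hR : (16 : ℝ) ≤ R := by exact_mod_cast P.hR
  have h1 : (rinv R n0 n : ℝ) ≤ ∏ l ∈ Finset.range n, ((R : ℝ) * Real.exp (if FF n0 l then (l : ℝ) / 4 else 0)) := by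
    unfold rinv
    push_cast
    apply Finset.prod_le_prod
    · intros; positivity
    · intro l _
      unfold ratio
      split_ifs with h
      · have := P.hexp l h.1
        have h2 : (1 : ℝ) ≤ Real.exp 1 := by simp
        push_cast
        have h3 := Real.exp_pos ((l : ℝ) / 4)
        nlinarith [sq_nonneg (l : ℝ)]
      · simp
  rw [Finset.prod_mul_distrib, Finset.prod_const, Finset.card_range, ← Real.exp_sum] at h1
  refine h1.trans ?_
  gcongr
  exact sum_FF' n0 n

lemma exp_half_le (P : Par t R n0) : Real.exp (1 / 2) ≤ R := by
  have hR : (16 : ℝ) ≤ R := by exact_mod_cast P.hR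
  have h1 : Real.exp (1 / 2) ≤ Real.exp 1 := Real.exp_le_exp.mpr (by norm_num)
  have := Real.exp_one_lt_d9
  linarith

lemma Par.rinv_le' (P : Par t R n0) (n : ℕ) : (rinv R n0 n : ℝ) ≤ R ^ (2 * n) := by
  refine (P.rinv_le n).trans ?_
  rw [two_mul, pow_add]
  gcongr
  have : (n : ℝ) / 2 = n * (1 / 2) := by ring
  rw [this, Real.exp_nat_mul]
  gcongr
  exact exp_half_le P

/-- separation of forced levels -/
lemma Par.sep (P : Par t R n0) {l n : ℕ} (hl : FF n0 l) (hn : FF n0 n) (hln : l < n) :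
    rinv R n0 (l + 1) ^ 2 ≤ rinv R n0 n := by
  have hR : (16 : ℝ) ≤ R := by exact_mod_cast P.hR
  have hl3 : 4 ≤ l := by
    have := hl.1; have := P.hn0; have := P.hR; nlinarith
  have h4 : 4 * l ≤ n := by
    obtain ⟨_, j, rfl⟩ := hl
    obtain ⟨_, i, rfl⟩ := hn
    have : j < i := (Nat.pow_lt_pow_iff_right (by norm_num)).mp hln
    calc 4 * 4 ^ j = 4 ^ (j + 1) := by rw [pow_succ]; ring
      _ ≤ 4 ^ i := Nat.pow_le_pow_right (by norm_num) this
  have h1 := P.rinv_le (l + 1)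
  have h2 : Real.exp (((l + 1 : ℕ) : ℝ) / 2) ^ 2 ≤ (R : ℝ) ^ (l + 1) := by
    rw [← Real.exp_nat_mul]
    have : ((2 : ℕ) : ℝ) * (((l + 1 : ℕ) : ℝ) / 2) = ((l + 1 : ℕ) : ℝ) * 1 := by push_cast; ring
    rw [this, Real.exp_nat_mul]
    gcongr
    have := Real.exp_one_lt_d9
    linarith
  have h3 : ((rinv R n0 (l + 1) : ℝ)) ^ 2 ≤ (R : ℝ) ^ n := by
    calc ((rinv R n0 (l + 1) : ℝ)) ^ 2 ≤ ((R : ℝ) ^ (l + 1) * Real.exp (((l + 1 : ℕ) : ℝ) / 2)) ^ 2 := by gcongr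
      _ = ((R : ℝ) ^ (l + 1)) ^ 2 * Real.exp (((l + 1 : ℕ) : ℝ) / 2) ^ 2 := by ring
      _ ≤ ((R : ℝ) ^ (l + 1)) ^ 2 * (R : ℝ) ^ (l + 1) := by gcongr
      _ = (R : ℝ) ^ (3 * (l + 1)) := by ring
      _ ≤ (R : ℝ) ^ n := pow_le_pow_right₀ (by linarith) (by omega)
  have h5 : rinv R n0 (l + 1) ^ 2 ≤ R ^ n := by exact_mod_cast h3
  exact h5.trans (P.rinv_ge n)

open Classical in
noncomputable def lam (R n0 l : ℕ) : ENNReal := if FF n0 l then 1 else ENNReal.ofReal (3 / (R - 3))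

lemma Par.prod_lam (P : Par t R n0) (m : ℕ) :
    ∏ l ∈ Finset.range m, lam R n0 l ≤ (R : ENNReal) * ENNReal.ofReal ((1 / rinv R n0 (m + 1) : ℝ) ^ t) := by
  classical
  have ht0 := P.ht0
  have ht1 := P.ht1
  have hR : (16 : ℝ) ≤ R := by exact_mod_cast P.hR
  set lr : ℕ → ℝ := fun l => if FF n0 l then 1 else 3 / (R - 3) with hlr
  have hlr0 : ∀ l, 0 ≤ lr l := by
    intro l; simp only [hlr]; split_ifs
    · norm_num
    · apply div_nonneg <;> linarith
  have e1 : ∏ l ∈ Finset.range m, lam R n0 l = ENNReal.ofReal (∏ l ∈ Finset.range m, lr l) := by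
    rw [ENNReal.ofReal_prod_of_nonneg (fun l _ => hlr0 l)]
    apply Finset.prod_congr rfl
    intro l _
    simp only [lam, hlr]
    split_ifs <;> simp
  have hsq : ∀ l : ℕ, FF n0 l → ((l ^ 2 : ℕ) : ℝ) ^ t ≤ (l : ℝ) ^ 2 := by
    intro l hl
    have h1 : (1 : ℝ) ≤ l := by
      have := hl.1; have := P.hn0; have := P.hR
      exact_mod_cast (by nlinarith : 1 ≤ l)
    push_cast
    nth_rewrite 2 [← Real.rpow_one ((l : ℝ) ^ 2)]
    exact Real.rpow_le_rpow_of_exponent_le (by nlinarith) ht1.le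
  have h1 : (∏ l ∈ Finset.range m, lr l) * (rinv R n0 m : ℝ) ^ t ≤ Real.exp (-(m / 2)) := by
    have : (rinv R n0 m : ℝ) ^ t = ∏ l ∈ Finset.range m, (ratio R n0 l : ℝ) ^ t := by
      unfold rinv
      push_cast
      rw [Real.finsetProd_rpow _ _ (fun _ _ => by positivity)]
    rw [this, ← Finset.prod_mul_distrib]
    calc _ ≤ ∏ l ∈ Finset.range m, Real.exp ((if FF n0 l then (l : ℝ) / 4 else 0) + (-1)) := by
          apply Finset.prod_le_prod
          · intro l _
            exact mul_nonneg (hlr0 l) (by positivity)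
          · intro l _
            simp only [hlr, ratio]
            rw [Real.exp_add, Real.exp_neg]
            split_ifs with h
            · rw [one_mul]
              refine (hsq l h).trans ?_
              rw [← div_eq_mul_inv, le_div_iff₀ (Real.exp_pos 1), mul_comm]
              exact P.hexp l h.1
            · have h3 := P.hRt
              have h4 : (0 : ℝ) < R - 3 := by linarith
              rw [Real.exp_zero, one_mul, div_mul_eq_mul_div, div_le_iff₀ h4, ← one_div,
                one_div_mul_eq_div, le_div_iff₀ (Real.exp_pos 1)]
              linarith
      _ = Real.exp (∑ l ∈ Finset.range m, ((if FF n0 l then (l : ℝ) / 4 else 0) + (-1))) := by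
          rw [Real.exp_sum]
      _ ≤ _ := by
          apply Real.exp_le_exp.mpr
          rw [Finset.sum_add_distrib]
          have := sum_FF' n0 m
          simp only [Finset.sum_const, Finset.card_range, nsmul_eq_mul]
          linarith
  have h2 : (ratio R n0 m : ℝ) ^ t ≤ R * Real.exp (m / 2) := by
    unfold ratio
    split_ifs with h
    · refine (hsq m h).trans ?_
      have h3 := P.hexp m h.1
      have h4 : (1 : ℝ) ≤ Real.exp 1 := by simp
      have h5 : Real.exp ((m : ℝ) / 4) ≤ Real.exp (m / 2) := by
        apply Real.exp_le_exp.mpr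
        have : (0 : ℝ) ≤ m := by positivity
        linarith
      have h6 := Real.exp_pos ((m : ℝ) / 2)
      nlinarith [sq_nonneg (m : ℝ)]
    · have h3 : (R : ℝ) ^ t ≤ R := by
        nth_rewrite 2 [← Real.rpow_one (R : ℝ)]
        exact Real.rpow_le_rpow_of_exponent_le (by linarith) ht1.le
      have h4 : 1 ≤ Real.exp ((m : ℝ) / 2) := Real.one_le_exp (by positivity)
      nlinarith
  have hpos : (0 : ℝ) < rinv R n0 (m + 1) := by exact_mod_cast P.rinv_pos (m + 1)
  rw [e1, ← ENNReal.ofReal_natCast, ← ENNReal.ofReal_mul (by positivity)]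
  apply ENNReal.ofReal_le_ofReal
  rw [one_div, Real.inv_rpow hpos.le, ← div_eq_mul_inv, le_div_iff₀ (by positivity), rinv_succ]
  push_cast
  rw [Real.mul_rpow (by positivity) (by positivity), ← mul_assoc]
  calc _ ≤ Real.exp (-(m / 2)) * (R * Real.exp (m / 2)) := by
        apply mul_le_mul h1 h2 (by positivity) (by positivity)
    _ = R := by rw [Real.exp_neg]; field_simp

end


end
end Lit

namespace Lit
section
open Set


noncomputable def rr (R n0 n : ℕ) : ℝ := 1 / (rinv R n0 n : ℝ)

noncomputable def c1 (R : ℕ) : ℝ := 1 / (256 * (R : ℝ) ^ 2)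

def InRange (R n0 n : ℕ) (w : ℚ) : Prop :=
  rinv R n0 n ≤ 4 * R * w.den ^ 2 ∧ 4 * R * w.den ^ 2 < rinv R n0 (n + 1)

structure StepProp (R n0 n : ℕ) (J : Set ℝ) (V : ℚ) : Prop where
  lo : FF n0 n → rinv R n0 n ≤ 4 * R * V.den ^ 2
  hi : FF n0 n → V.den ^ 2 ≤ 4 * (32 * R) ^ 2 * rinv R n0 n
  dlo : FF n0 n → ∀ z ∈ J, rr R n0 (n + 1) ≤ |z - V|
  dhi : FF n0 n → ∀ z ∈ J, |z - V| ≤ 2 * rr R n0 (n + 1)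
  other : ∀ w : ℚ, InRange R n0 n w → (FF n0 n ∧ w = V) ∨ ∀ z ∈ J, c1 R / (w.den : ℝ) ^ 2 ≤ |z - w|

lemma StepProp.mono {R n0 n : ℕ} {J J' : Set ℝ} {V : ℚ} (h : StepProp R n0 n J V) (hJ : J' ⊆ J) :
    StepProp R n0 n J' V where
  lo := h.lo
  hi := h.hi
  dlo := fun hf z hz => h.dlo hf z (hJ hz)
  dhi := fun hf z hz => h.dhi hf z (hJ hz)
  other := fun w hw => (h.other w hw).imp id fun h z hz => h z (hJ hz)

def GG (R n0 n : ℕ) (x : ℝ) : Prop :=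
  ∀ m < n, ∃ V, StepProp R n0 m (Icc x (x + rr R n0 n)) V

lemma rat_sep {v w : ℚ} (h : v ≠ w) : 1 / ((v.den : ℝ) * w.den) ≤ |(v : ℝ) - w| := by
  have hv : (0 : ℝ) < v.den := by exact_mod_cast v.den_pos
  have hw : (0 : ℝ) < w.den := by exact_mod_cast w.den_pos
  have e : (v : ℝ) - w = ((v.num * w.den - w.num * v.den : ℤ) : ℝ) / ((v.den : ℝ) * w.den) := by
    rw [Rat.cast_def v, Rat.cast_def w]
    push_cast
    field_simp
  rw [e, abs_div, abs_of_pos (mul_pos hv hw)]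
  apply div_le_div_of_nonneg_right _ (mul_pos hv hw).le
  rw [← Int.cast_abs]
  have : v.num * w.den - w.num * v.den ≠ 0 := by
    intro h0
    apply h
    rw [Rat.eq_iff_mul_eq_mul]
    linarith
  exact_mod_cast Int.one_le_abs this

section
variable {t : ℝ} {R n0 : ℕ}

lemma exists_range (a n : ℕ) (h0 : 1 ≤ a) (hn : a < rinv R n0 n) :
    ∃ m < n, rinv R n0 m ≤ a ∧ a < rinv R n0 (m + 1) := by
  induction n with
  | zero => rw [rinv_zero] at hn; omega
  | succ n ih =>
    by_cases h : a < rinv R n0 n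
    · obtain ⟨m, hm, h1⟩ := ih h
      exact ⟨m, by omega, h1⟩
    · exact ⟨n, by omega, by omega, hn⟩

lemma Par.rr_pos (P : Par t R n0) (n : ℕ) : 0 < rr R n0 n := by
  have : (0 : ℝ) < rinv R n0 n := by exact_mod_cast P.rinv_pos n
  unfold rr; positivity

lemma normal_step (P : Par t R n0) (n : ℕ) (hn : ¬ FF n0 n) (x : ℝ) :
    rr R n0 n = R * rr R n0 (n + 1) ∧
    ∃ good : Finset ℕ, good ⊆ Finset.range R ∧ R ≤ good.card + 3 ∧
      ∀ i ∈ good, StepProp R n0 n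
        (Icc (x + i * rr R n0 (n + 1)) (x + i * rr R n0 (n + 1) + rr R n0 (n + 1))) 0 := by
  classical
  have hR : (16 : ℝ) ≤ R := by exact_mod_cast P.hR
  have hρ : (0 : ℝ) < rinv R n0 n := by exact_mod_cast P.rinv_pos n
  have hs : rinv R n0 (n + 1) = rinv R n0 n * R := by
    rw [rinv_succ]; simp [ratio, hn]
  have hrr : rr R n0 n = R * rr R n0 (n + 1) := by
    unfold rr; rw [hs]; push_cast; field_simp
  refine ⟨hrr, ?_⟩
  set h := rr R n0 (n + 1) with hh
  have hh0 : 0 < h := P.rr_pos (n + 1)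
  -- bound on c1/den²
  have hc1 : ∀ w : ℚ, InRange R n0 n w → c1 R / (w.den : ℝ) ^ 2 ≤ h := by
    intro w hw
    have hd : (0 : ℝ) < w.den := by exact_mod_cast w.den_pos
    have h1 : (rinv R n0 n : ℝ) ≤ 4 * R * w.den ^ 2 := by exact_mod_cast hw.1
    rw [hh]; unfold c1 rr; rw [hs, div_div]
    push_cast
    apply one_div_le_one_div_of_le (by positivity)
    nlinarith [sq_nonneg (w.den : ℝ)]
  have hden : ∀ w : ℚ, InRange R n0 n w → 4 * (w.den : ℝ) ^ 2 < rinv R n0 n := by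
    intro w hw
    have h1 : (4 * R * w.den ^ 2 : ℝ) < rinv R n0 n * R := by
      have := hw.2; rw [hs] at this; exact_mod_cast this
    nlinarith
  let near : ℚ → Prop := fun w => InRange R n0 n w ∧ ∃ z ∈ Icc x (x + R * h), |z - w| < c1 R / (w.den : ℝ) ^ 2
  have huniq : ∀ w w', near w → near w' → w = w' := by
    rintro w w' ⟨hw, z, hz, hzw⟩ ⟨hw', z', hz', hzw'⟩
    by_contra hne
    have h1 := rat_sep hne
    have hd : (0 : ℝ) < w.den := by exact_mod_cast w.den_pos
    have hd' : (0 : ℝ) < w'.den := by exact_mod_cast w'.den_pos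
    have h2 : 4 * rr R n0 n ≤ 1 / ((w.den : ℝ) * w'.den) := by
      unfold rr
      rw [mul_one_div, div_le_div_iff₀ hρ (by positivity)]
      nlinarith [hden w hw, hden w' hw', sq_nonneg ((w.den : ℝ) - w'.den)]
    have h3 := hzw.le.trans (hc1 w hw)
    have h4 := hzw'.le.trans (hc1 w' hw')
    have h5 : |(w : ℝ) - w'| ≤ h + R * h + h := by
      rw [abs_le] at h3 h4 ⊢
      constructor <;> linarith [h3.1, h3.2, h4.1, h4.2, hz.1, hz.2, hz'.1, hz'.2]
    rw [hrr] at h2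
    nlinarith
  by_cases hex : ∃ w0, near w0
  · obtain ⟨w0, hw0⟩ := hex
    set u := ((w0 : ℝ) - x) / h with hu
    have hu' : (w0 : ℝ) = x + u * h := by rw [hu]; field_simp; ring
    set bad : Finset ℤ := Finset.Icc (⌊u⌋ - 1) (⌊u⌋ + 1)
    refine ⟨(Finset.range R).filter (fun i : ℕ => (i : ℤ) ∉ bad), Finset.filter_subset _ _, ?_, ?_⟩
    · have h1 := Finset.card_filter_add_card_filter_not (s := Finset.range R) (fun i : ℕ => (i : ℤ) ∈ bad)
      have h2 : ((Finset.range R).filter (fun i : ℕ => (i : ℤ) ∈ bad)).card ≤ bad.card := by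
        apply Finset.card_le_card_of_injOn (fun i : ℕ => (i : ℤ))
        · intro i hi
          simp only [Finset.coe_filter, mem_ofPred_eq] at hi
          exact hi.2
        · intro a _ b _ hab
          simpa using hab
      have h3 : bad.card = 3 := by
        simp only [bad, Int.card_Icc]; omega
      rw [Finset.card_range] at h1
      omega
    · intro i hi
      rw [Finset.mem_filter, Finset.mem_range] at hi
      refine ⟨fun hf => absurd hf hn, fun hf => absurd hf hn, fun hf => absurd hf hn,
        fun hf => absurd hf hn, fun w hw => Or.inr fun z hz => ?_⟩
      by_contra hcon
      push Not at hcon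
      have hi1 : ((i : ℝ) + 1) ≤ R := by exact_mod_cast hi.1
      have hnear : near w := by
        refine ⟨hw, z, ⟨?_, ?_⟩, hcon⟩
        · have : 0 ≤ (i : ℝ) * h := by positivity
          linarith [hz.1]
        · nlinarith [hz.2]
      have heq := huniq w w0 hnear hw0
      subst heq
      have h3 := abs_lt.mp (lt_of_lt_of_le hcon (hc1 w hw))
      rw [hu'] at h3
      apply hi.2
      have h4 : (i : ℝ) < u + 1 := by
        have : (i : ℝ) * h < (u + 1) * h := by linarith [hz.1, h3.2]
        exact lt_of_mul_lt_mul_right this hh0.le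
      have h5 : u - 2 < i := by
        have : (u - 2) * h < i * h := by linarith [hz.2, h3.1]
        exact lt_of_mul_lt_mul_right this hh0.le
      have h6 := Int.floor_le u
      have h7 := Int.lt_floor_add_one u
      rw [Finset.mem_Icc]
      constructor
      · have : ((⌊u⌋ - 2 : ℤ) : ℝ) < ((i : ℤ) : ℝ) := by push_cast; linarith
        have := Int.cast_lt.mp this
        omega
      · have : ((i : ℤ) : ℝ) < ((⌊u⌋ + 2 : ℤ) : ℝ) := by push_cast; linarith
        have := Int.cast_lt.mp this
        omega
  · push Not at hex
    refine ⟨Finset.range R, subset_rfl, by simp, fun i hi => ?_⟩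
    rw [Finset.mem_range] at hi
    refine ⟨fun hf => absurd hf hn, fun hf => absurd hf hn, fun hf => absurd hf hn,
        fun hf => absurd hf hn, fun w hw => Or.inr fun z hz => ?_⟩
    by_contra hcon
    push Not at hcon
    have hi1 : ((i : ℝ) + 1) ≤ R := by exact_mod_cast hi
    refine hex w ⟨hw, z, ⟨?_, ?_⟩, hcon⟩
    · have : 0 ≤ (i : ℝ) * h := by positivity
      linarith [hz.1]
    · nlinarith [hz.2]

set_option maxHeartbeats 1600000 in
lemma forced_step (P : Par t R n0) (n : ℕ) (hn : FF n0 n) (x : ℝ) (hG : GG R n0 n x) :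
    ∃ x', Icc x' (x' + rr R n0 (n + 1)) ⊆ Icc x (x + rr R n0 n) ∧
      ∃ V, StepProp R n0 n (Icc x' (x' + rr R n0 (n + 1))) V := by
  have hR : (16 : ℝ) ≤ R := by exact_mod_cast P.hR
  have hρN := P.rinv_pos n
  have hρ : (0 : ℝ) < rinv R n0 n := by exact_mod_cast hρN
  have hs : rinv R n0 (n + 1) = rinv R n0 n * n ^ 2 := by
    rw [rinv_succ]; simp [ratio, hn]
  have hr0 := P.rr_pos n
  have hr1 := P.rr_pos (n + 1)
  have hnb : (128 * R ^ 2 : ℝ) ≤ n := by exact_mod_cast P.hn0.trans hn.1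
  have hn16 : (128 : ℝ) ≤ n := by nlinarith
  set ρ : ℕ := rinv R n0 n with hρdef
  set r := rr R n0 n with hr
  have hrρ : r * ρ = 1 := by rw [hr]; unfold rr; rw [← hρdef]; field_simp
  have hr' : rr R n0 (n + 1) = r / n ^ 2 := by
    rw [hr]; unfold rr; rw [hs]; push_cast; rw [div_div]
  set y := x + r / 2 with hy
  have hyI : y ∈ Icc x (x + r) := ⟨by linarith, by linarith⟩
  set N : ℕ := 32 * R * (Nat.sqrt ρ + 1) with hN
  have hN1 : (32 * R) ^ 2 * ρ ≤ N ^ 2 := by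
    rw [hN, mul_pow (32 * R) (Nat.sqrt ρ + 1)]
    exact Nat.mul_le_mul le_rfl (by have := Nat.lt_succ_sqrt' ρ; exact this.le)
  have hN2 : N ^ 2 ≤ 4 * (32 * R) ^ 2 * ρ := by
    have h1 : 1 ≤ Nat.sqrt ρ := Nat.sqrt_pos.mpr hρN
    have h2 : Nat.sqrt ρ ^ 2 ≤ ρ := Nat.sqrt_le' ρ
    have h3 : (Nat.sqrt ρ + 1) ^ 2 ≤ 4 * ρ := by nlinarith
    rw [hN, mul_pow (32 * R) (Nat.sqrt ρ + 1)]
    calc _ ≤ (32 * R) ^ 2 * (4 * ρ) := Nat.mul_le_mul le_rfl h3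
      _ = _ := by ring
  have hNpos : 0 < N := by
    rw [hN]; have := P.hR; positivity
  obtain ⟨v, hv1, hv2⟩ := Real.exists_rat_abs_sub_le_and_den_le y hNpos
  set d : ℝ := (v.den : ℝ) with hd
  have hd0 : 0 < d := by rw [hd]; exact_mod_cast v.den_pos
  have hd1 : 1 ≤ d := by rw [hd]; exact_mod_cast v.den_pos
  have hN1r : (32 * (R : ℝ)) ^ 2 * ρ ≤ (N : ℝ) ^ 2 := by exact_mod_cast hN1
  have hN0r : (0 : ℝ) < N := by exact_mod_cast hNpos
  have hdN : d ≤ N := by rw [hd]; exact_mod_cast hv2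
  -- the small denominator case
  have small : 4 * R * v.den ^ 2 < ρ → ∃ m < n, InRange R n0 m v := by
    intro hlt
    obtain ⟨m, hm, h1⟩ := exists_range (4 * R * v.den ^ 2) n (by
      have := P.hR; have := v.den_pos; nlinarith [Nat.pow_pos (n := 2) v.den_pos]) hlt
    exact ⟨m, hm, h1⟩
  have hclose : |y - v| ≤ r / 4 := by
    have suff : 4 * (ρ : ℝ) ≤ (N + 1) * d := by
      by_cases hlt : 4 * R * v.den ^ 2 < ρ
      · obtain ⟨m, hm, hmr⟩ := small hlt
        obtain ⟨V, hV⟩ := hG m hm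
        rcases hV.other v hmr with ⟨hf, hvV⟩ | hfar
        · exfalso
          have h1 := (hV.dlo hf y hyI)
          rw [← hvV] at h1
          have h2 : rr R n0 (m + 1) ≤ 1 / N := by
            refine (h1.trans hv1).trans ?_
            apply one_div_le_one_div_of_le hN0r
            nlinarith
          unfold rr at h2
          have hm0 : (0 : ℝ) < rinv R n0 (m + 1) := by exact_mod_cast P.rinv_pos _
          rw [one_div_le_one_div hm0 hN0r] at h2
          have h3 : N ≤ rinv R n0 (m + 1) := by exact_mod_cast h2
          have h4 := P.sep hf hn hm
          have h5 : N ^ 2 ≤ rinv R n0 (m + 1) ^ 2 := Nat.pow_le_pow_left h3 2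
          have h6 : ρ < (32 * R) ^ 2 * ρ := by
            have := P.hR
            have : 2 ≤ (32 * R) ^ 2 := by nlinarith
            nlinarith
          rw [← hρdef] at h4
          omega
        · have h1 := (hfar y hyI).trans hv1
          rw [← hd] at h1
          unfold c1 at h1
          rw [div_div, div_le_div_iff₀ (by positivity) (by positivity)] at h1
          have h2 : (N + 1 : ℝ) ≤ 256 * R ^ 2 * d := by nlinarith
          have h3 : (N : ℝ) ^ 2 ≤ 256 * R ^ 2 * ((N + 1) * d) := by nlinarith
          have hR2 : (0 : ℝ) < 256 * R ^ 2 := by positivity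
          have h4 : 256 * (R : ℝ) ^ 2 * (4 * ρ) ≤ 256 * R ^ 2 * ((N + 1) * d) := by
            refine le_trans (le_of_eq ?_) (hN1r.trans h3); ring
          exact le_of_mul_le_mul_left h4 hR2
      · push Not at hlt
        have h1 : (ρ : ℝ) ≤ 4 * R * d ^ 2 := by rw [hd]; exact_mod_cast hlt
        have h2 : (4 * (ρ : ℝ)) ^ 2 ≤ (N * d) ^ 2 := by
          have h3 : (32 * (R : ℝ)) ^ 2 * ρ * d ^ 2 ≤ (N : ℝ) ^ 2 * d ^ 2 := by gcongr
          have h4 : (32 * (R : ℝ)) ^ 2 * ρ * d ^ 2 = 256 * R * ρ * (4 * R * d ^ 2) := by ring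
          have h5 : 256 * R * ρ * (ρ : ℝ) ≤ 256 * R * ρ * (4 * R * d ^ 2) := by gcongr
          have h6 : (4 * (ρ : ℝ)) ^ 2 ≤ 256 * R * ρ * (ρ : ℝ) := by nlinarith [mul_pos hρ hρ]
          rw [mul_pow]
          linarith
        have := abs_le_of_sq_le_sq' h2 (by positivity)
        linarith [this.2]
    refine hv1.trans ?_
    rw [div_le_div_iff₀ (by positivity) (by norm_num)]
    have h7 : r * (4 * ρ) ≤ r * ((N + 1) * d) := by gcongr
    linarith
  have hcl := abs_le.mp hclose
  have hvI : (v : ℝ) ∈ Icc x (x + r) := ⟨by linarith [hcl.2], by linarith [hcl.1]⟩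
  have hbig : ρ ≤ 4 * R * v.den ^ 2 := by
    by_contra hlt
    push Not at hlt
    obtain ⟨m, hm, hmr⟩ := small hlt
    obtain ⟨V, hV⟩ := hG m hm
    rcases hV.other v hmr with ⟨hf, hvV⟩ | hfar
    · have h1 := hV.dlo hf v hvI
      rw [← hvV, sub_self, abs_zero] at h1
      exact absurd (P.rr_pos (m + 1)) (not_lt.mpr h1)
    · have h1 := hfar v hvI
      rw [sub_self, abs_zero] at h1
      have : 0 < c1 R / (v.den : ℝ) ^ 2 := by rw [← hd]; unfold c1; positivity
      linarith
  have hdhi : v.den ^ 2 ≤ 4 * (32 * R) ^ 2 * ρ := (Nat.pow_le_pow_left hv2 2).trans hN2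
  set r' := rr R n0 (n + 1) with hr'def
  have h8 : 16 * r' ≤ r := by
    rw [hr', mul_div_assoc', div_le_iff₀ (by positivity)]
    nlinarith
  have hz : ∀ z ∈ Icc ((v : ℝ) + r') (v + r' + r'), r' ≤ |z - v| ∧ |z - v| ≤ 2 * r' := by
    intro z hz
    rw [abs_of_nonneg (by linarith [hz.1])]
    constructor <;> linarith [hz.1, hz.2]
  refine ⟨v + r', ?_, v, fun _ => hbig, fun _ => hdhi, fun _ z h => (hz z h).1,
    fun _ z h => (hz z h).2, ?_⟩
  · intro z hz
    constructor
    · linarith [hz.1, hcl.2]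
    · linarith [hz.2, hcl.1]
  · intro w hw
    by_cases hwv : w = v
    · exact Or.inl ⟨hn, hwv⟩
    · refine Or.inr fun z hzI => ?_
      have h1 := rat_sep hwv
      set e : ℝ := (w.den : ℝ) with he
      have he0 : 0 < e := by rw [he]; exact_mod_cast w.den_pos
      rw [← hd] at h1
      have hw1 : (ρ : ℝ) ≤ 4 * R * e ^ 2 := by rw [he]; exact_mod_cast hw.1
      have hw2 : 4 * R * e ^ 2 < ρ * (n : ℝ) ^ 2 := by
        have := hw.2; rw [hs] at this; rw [he]; exact_mod_cast this
      have hdr : d ^ 2 ≤ 4 * (32 * R) ^ 2 * ρ := by rw [hd]; exact_mod_cast hdhi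
      have h2 : 2 * r' ≤ 1 / (2 * (e * d)) := by
        have hsq : (4 * (e * d)) ^ 2 ≤ (ρ * (n : ℝ) ^ 2) ^ 2 := by
          have a1 : 4 * R * e ^ 2 * d ^ 2 ≤ (ρ * (n : ℝ) ^ 2) * (4 * (32 * R) ^ 2 * ρ) := by
            apply mul_le_mul hw2.le hdr (by positivity) (by positivity)
          have a2 : 16 * (32 * (R : ℝ)) ^ 2 ≤ R * n ^ 2 := by nlinarith [sq_nonneg (R : ℝ), mul_pos (show (0:ℝ) < R by linarith) (show (0:ℝ) < R by linarith)]
          have a3 : (R : ℝ) * (4 * (e * d)) ^ 2 ≤ R * (ρ * (n : ℝ) ^ 2) ^ 2 := by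
            calc (R : ℝ) * (4 * (e * d)) ^ 2 = 4 * (4 * R * e ^ 2 * d ^ 2) := by ring
              _ ≤ 4 * ((ρ * (n : ℝ) ^ 2) * (4 * (32 * R) ^ 2 * ρ)) := by gcongr
              _ = ρ ^ 2 * (n : ℝ) ^ 2 * (16 * (32 * (R : ℝ)) ^ 2) := by ring
              _ ≤ ρ ^ 2 * (n : ℝ) ^ 2 * (R * n ^ 2) := by gcongr
              _ = _ := by ring
          exact le_of_mul_le_mul_left a3 (by linarith)
        have h4 := (abs_le_of_sq_le_sq' hsq (by positivity)).2
        rw [hr', le_div_iff₀ (by positivity), mul_div_assoc', div_mul_eq_mul_div,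
          div_le_iff₀ (by positivity)]
        have h5 : r * (4 * (e * d)) ≤ r * (ρ * (n : ℝ) ^ 2) := by gcongr
        have h6 : r * (ρ * (n : ℝ) ^ 2) = n ^ 2 := by rw [← mul_assoc, hrρ, one_mul]
        linarith
      have h3 : |(w : ℝ) - v| ≤ |z - v| + |z - w| := by
        have := abs_sub_le (w : ℝ) z v
        rw [abs_sub_comm (w : ℝ) z] at this
        linarith
      have h4 := (hz z hzI).2
      have h5 : 1 / (e * d) = 2 * (1 / (2 * (e * d))) := by field_simp
      refine le_trans ?_ (show 1 / (2 * (e * d)) ≤ |z - w| by linarith)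
      unfold c1
      rw [div_div]
      apply one_div_le_one_div_of_le (by positivity)
      have h6 : (2 * d) ^ 2 ≤ (256 * R ^ 2 * e) ^ 2 := by
        have b1 : (256 * (R : ℝ) ^ 2 * e) ^ 2 = 16384 * R ^ 3 * (4 * R * e ^ 2) := by ring
        have b2 : 16384 * (R : ℝ) ^ 3 * ρ ≤ 16384 * R ^ 3 * (4 * R * e ^ 2) := by gcongr
        have b3 : (2 * d) ^ 2 ≤ 16384 * R ^ 2 * ρ := by nlinarith
        have b4 : 16384 * (R : ℝ) ^ 2 * ρ ≤ 16384 * (R : ℝ) ^ 3 * ρ := by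
          have : (R : ℝ) ^ 2 ≤ R ^ 3 := by nlinarith [sq_nonneg (R : ℝ)]
          gcongr
        linarith
      have h7 := (abs_le_of_sq_le_sq' h6 (by positivity)).2
      nlinarith

end


end
end Lit

namespace Lit
section
open Set


def AStep (R n0 : ℕ) (α : ℝ) : Prop := ∀ n, ∃ V, StepProp R n0 n {α} V

lemma meets_mono (A : ℕ → Set ℝ) (w : ℕ → ENNReal) {I J : Set ℝ} (h : I ⊆ J) :
    meets A w I ≤ meets A w J := by
  unfold meets
  apply ENNReal.tsum_le_tsum
  intro i
  split_ifs with h4 h5 h5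
  · exact le_rfl
  · exact absurd (h4.mono (inter_subset_inter_right _ h)) h5
  · exact zero_le
  · exact le_rfl

section
variable {t : ℝ} {R n0 : ℕ}

lemma GG_succ {n : ℕ} {x x' : ℝ} (hG : GG R n0 n x)
    (hsub : Icc x' (x' + rr R n0 (n + 1)) ⊆ Icc x (x + rr R n0 n)) {V : ℚ}
    (hV : StepProp R n0 n (Icc x' (x' + rr R n0 (n + 1))) V) : GG R n0 (n + 1) x' := by
  intro m hm
  rcases Nat.lt_succ_iff_lt_or_eq.mp hm with h | rfl
  · obtain ⟨W, hW⟩ := hG m h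
    exact ⟨W, hW.mono hsub⟩
  · exact ⟨V, hV⟩

lemma tree_step (P : Par t R n0) (n : ℕ) (x : ℝ) (hG : GG R n0 n x)
    (A : ℕ → Set ℝ) (w : ℕ → ENNReal)
    (hA : ∀ i, ∀ y ∈ A i, ∀ z ∈ A i, |y - z| ≤ rr R n0 (n + 1)) :
    ∃ x', GG R n0 (n + 1) x' ∧ Icc x' (x' + rr R n0 (n + 1)) ⊆ Icc x (x + rr R n0 n) ∧
      meets A w (Icc x' (x' + rr R n0 (n + 1))) ≤ lam R n0 n * meets A w (Icc x (x + rr R n0 n)) := by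
  by_cases hn : FF n0 n
  · obtain ⟨x', hsub, V, hV⟩ := forced_step P n hn x hG
    refine ⟨x', GG_succ hG hsub hV, hsub, ?_⟩
    simp only [lam, hn, if_true, one_mul]
    exact meets_mono A w hsub
  · obtain ⟨hrr, good, hg1, hg2, hg3⟩ := normal_step P n hn x
    have hh := P.rr_pos (n + 1)
    obtain ⟨j, hj, hj2⟩ := average x _ hh R good hg1 hg2 (by have := P.hR; omega) A w hA
    have hsub : Icc (x + j * rr R n0 (n + 1)) (x + j * rr R n0 (n + 1) + rr R n0 (n + 1)) ⊆
        Icc x (x + rr R n0 n) := by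
      have h1 := Finset.mem_range.mp (hg1 hj)
      have h2 : (j : ℝ) + 1 ≤ R := by exact_mod_cast h1
      have h3 : 0 ≤ (j : ℝ) * rr R n0 (n + 1) := by positivity
      apply Icc_subset_Icc
      · linarith
      · rw [hrr]; nlinarith
    refine ⟨x + j * rr R n0 (n + 1), GG_succ hG hsub (hg3 j hj), hsub, ?_⟩
    simp only [lam, hn, if_false]
    rw [hrr]
    exact hj2

lemma alpha_tree (P : Par t R n0) (U : ℕ → Set ℝ) (ρ : ℕ → ℝ)
    (hρ0 : ∀ i, 0 < ρ i) (hρ1 : ∀ i, ρ i ≤ 1) (hU : ∀ i, ∀ y ∈ U i, ∀ z ∈ U i, |y - z| ≤ ρ i)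
    (v : ℕ → ENNReal) : ∃ α, AStep R n0 α ∧
      ∑' i, (U i).indicator (fun _ => v i) α ≤ (R : ENNReal) * ∑' i, v i * ENNReal.ofReal (ρ i ^ t) := by
  classical
  have hR : (16 : ℝ) ≤ R := by exact_mod_cast P.hR
  have hanti : Antitone (rr R n0) := by
    intro a b hab
    have h1 : (0 : ℝ) < rinv R n0 a := by exact_mod_cast P.rinv_pos a
    unfold rr
    apply one_div_le_one_div_of_le h1
    exact_mod_cast P.rinv_mono hab
  have hm : ∀ i, ∃ m, ρ i ≤ rr R n0 m ∧ rr R n0 (m + 1) < ρ i := by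
    intro i
    have hex : ∃ k, rr R n0 (k + 1) < ρ i := by
      obtain ⟨k, hk⟩ := pow_unbounded_of_one_lt (1 / ρ i) (show (1 : ℝ) < R by linarith)
      refine ⟨k, ?_⟩
      unfold rr
      rw [one_div_lt (by exact_mod_cast P.rinv_pos _) (hρ0 i)]
      refine hk.trans_le ?_
      calc (R : ℝ) ^ k ≤ R ^ (k + 1) := pow_le_pow_right₀ (by linarith) (by omega)
        _ ≤ _ := by exact_mod_cast P.rinv_ge (k + 1)
    refine ⟨Nat.find hex, ?_, Nat.find_spec hex⟩
    rcases h : Nat.find hex with _ | k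
    · simp only [rr, rinv_zero]
      simpa using hρ1 i
    · have := Nat.find_min hex (m := k) (by omega)
      exact not_lt.mp this
  choose m hm1 hm2 using hm
  obtain ⟨α, h1, h2⟩ := greedy (rr R n0) (GG R n0) (lam R n0) (fun n => (P.rr_pos n).le) hanti 0
    (fun m hm => absurd hm (by omega)) (tree_step P) U ρ hU m hm1 v
  refine ⟨α, fun n => ?_, h2.trans ?_⟩
  · obtain ⟨x, hx, hxα⟩ := h1 (n + 1)
    obtain ⟨V, hV⟩ := hx n (by omega)
    exact ⟨V, hV.mono (singleton_subset_iff.mpr hxα)⟩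
  · rw [← ENNReal.tsum_mul_left]
    apply ENNReal.tsum_le_tsum
    intro i
    have h3 : ENNReal.ofReal (rr R n0 (m i + 1) ^ t) ≤ ENNReal.ofReal (ρ i ^ t) := by
      apply ENNReal.ofReal_le_ofReal
      exact Real.rpow_le_rpow (P.rr_pos _).le (hm2 i).le P.ht0.le
    calc _ ≤ v i * (R * ENNReal.ofReal (rr R n0 (m i + 1) ^ t)) := by
          gcongr
          exact P.prod_lam (m i)
      _ ≤ v i * (R * ENNReal.ofReal (ρ i ^ t)) := by gcongr
      _ = _ := by ring

end


end
end Lit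

namespace Lit
section
open Set


lemma half_window (α σ M : ℝ) (hσ : 0 < σ) (hσ1 : σ ≤ 1) (hM0 : 0 ≤ M) (s : Finset ℕ) (a W : ℕ)
    (hs : ∀ q ∈ s, a ≤ q ∧ q < a + W)
    (hd : ∀ d : ℕ, 1 ≤ d → d < W → σ ≤ nint (d * α))
    (hM : ∀ q ∈ s, 0 < nint ((q : ℕ) * α) ∧ 1 / nint ((q : ℕ) * α) ≤ M)
    (ε : ℝ) (hε : |ε| = 1)
    (hsgn : ∀ q ∈ s, (q : ℕ) * α - round ((q : ℕ) * α) = ε * nint ((q : ℕ) * α)) :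
    ∑ q ∈ s, 1 / nint ((q : ℕ) * α) ≤ M + (1 / σ) * (1 + Real.log (1 / σ)) := by
  classical
  set φ : ℕ → ℕ := fun q => ⌊nint (q * α) / σ⌋₊ with hφ
  set L : ℕ := ⌊1 / σ⌋₊ with hL
  set g : ℕ → ℝ := fun j => if j = 0 then M else 1 / (j * σ) with hg
  have hg0 : ∀ j, 0 ≤ g j := by
    intro j; simp only [hg]; split_ifs
    · exact hM0
    · positivity
  have key : ∀ q ∈ s, ∀ q' ∈ s, q < q' → φ q ≠ φ q' := by
    intro q hq q' hq' hlt heq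
    have h1 := hd (q' - q) (by omega) (by have := hs q hq; have := hs q' hq'; omega)
    have h2 : |nint (q' * α) / σ - nint (q * α) / σ| < 1 := by
      have a1 := Nat.floor_le (div_nonneg (nint_nonneg (q * α)) hσ.le)
      have a2 := Nat.lt_floor_add_one (nint (q * α) / σ)
      have a3 := Nat.floor_le (div_nonneg (nint_nonneg (q' * α)) hσ.le)
      have a4 := Nat.lt_floor_add_one (nint (q' * α) / σ)
      simp only [hφ] at heq
      rw [← heq] at a3 a4
      rw [abs_lt]; constructor <;> linarith
    rw [← sub_div, abs_div, abs_of_pos hσ, div_lt_one hσ] at h2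
    have h3 := nint_le (((q' - q : ℕ) : ℝ) * α) (round ((q' : ℝ) * α) - round ((q : ℝ) * α))
    have h4 : ((q' - q : ℕ) : ℝ) * α - ((round ((q' : ℝ) * α) - round ((q : ℝ) * α) : ℤ) : ℝ) =
        ε * (nint (q' * α) - nint (q * α)) := by
      rw [mul_sub, ← hsgn q hq, ← hsgn q' hq', Nat.cast_sub hlt.le]
      push_cast; ring
    rw [h4, abs_mul, hε, one_mul] at h3
    linarith
  have hinj : Set.InjOn φ s := by
    intro q hq q' hq' heq
    rcases lt_trichotomy q q' with h | h | h
    · exact absurd heq (key q hq q' hq' h)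
    · exact h
    · exact absurd heq.symm (key q' hq' q hq h)
  calc ∑ q ∈ s, 1 / nint ((q : ℕ) * α) ≤ ∑ q ∈ s, g (φ q) := by
        apply Finset.sum_le_sum
        intro q hq
        simp only [hg]
        split_ifs with h
        · exact (hM q hq).2
        · have h1 : 0 < φ q := Nat.pos_of_ne_zero h
          have h2 := Nat.floor_le (div_nonneg (nint_nonneg (q * α)) hσ.le)
          rw [le_div_iff₀ hσ] at h2
          apply one_div_le_one_div_of_le (by positivity)
          exact h2
    _ = ∑ j ∈ s.image φ, g j := (Finset.sum_image hinj).symm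
    _ ≤ ∑ j ∈ Finset.range (L + 1), g j := by
        apply Finset.sum_le_sum_of_subset_of_nonneg
        · intro j hj
          rw [Finset.mem_image] at hj
          obtain ⟨q, hq, rfl⟩ := hj
          rw [Finset.mem_range, Nat.lt_succ_iff]
          apply Nat.floor_le_floor
          gcongr
          have := nint_le_half (q * α)
          linarith
        · intro j _ _; exact hg0 j
    _ = M + (1 / σ) * (harmonic L : ℝ) := by
        rw [Finset.sum_range_succ', add_comm]
        congr 1
        unfold harmonic
        push_cast
        rw [Finset.mul_sum]
        apply Finset.sum_congr rfl
        intro j _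
        simp only [hg, Nat.succ_ne_zero, if_false]
        push_cast
        rw [one_div, mul_inv, one_div]; ring
    _ ≤ _ := by
        gcongr
        refine (harmonic_le_one_add_log L).trans ?_
        gcongr
        · have : 1 ≤ L := by
            rw [hL]; apply Nat.le_floor; rw [Nat.cast_one, le_div_iff₀ hσ]; linarith
          exact_mod_cast this
        · exact Nat.floor_le (by positivity)

lemma window (α σ M : ℝ) (hσ : 0 < σ) (hσ1 : σ ≤ 1) (hM0 : 0 ≤ M) (s : Finset ℕ) (a W : ℕ)
    (hs : ∀ q ∈ s, a ≤ q ∧ q < a + W)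
    (hd : ∀ d : ℕ, 1 ≤ d → d < W → σ ≤ nint (d * α))
    (hM : ∀ q ∈ s, 0 < nint ((q : ℕ) * α) ∧ 1 / nint ((q : ℕ) * α) ≤ M) :
    ∑ q ∈ s, 1 / nint ((q : ℕ) * α) ≤ 2 * M + 2 * ((1 / σ) * (1 + Real.log (1 / σ))) := by
  classical
  rw [← Finset.sum_filter_add_sum_filter_not s (fun q : ℕ => 0 ≤ (q : ℝ) * α - round ((q : ℝ) * α))]
  have h1 := half_window α σ M hσ hσ1 hM0
    (s.filter (fun q : ℕ => 0 ≤ (q : ℝ) * α - round ((q : ℝ) * α))) a W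
    (fun q hq => hs q (Finset.mem_filter.mp hq).1) hd (fun q hq => hM q (Finset.mem_filter.mp hq).1)
    1 (by simp) (fun q hq => by
      have := (Finset.mem_filter.mp hq).2
      unfold nint; rw [abs_of_nonneg this, one_mul])
  have h2 := half_window α σ M hσ hσ1 hM0
    (s.filter (fun q : ℕ => ¬ 0 ≤ (q : ℝ) * α - round ((q : ℝ) * α))) a W
    (fun q hq => hs q (Finset.mem_filter.mp hq).1) hd (fun q hq => hM q (Finset.mem_filter.mp hq).1)
    (-1) (by simp) (fun q hq => by
      have := (Finset.mem_filter.mp hq).2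
      push Not at this
      unfold nint; rw [abs_of_neg this]; ring)
  linarith

lemma block (c2 : ℝ) (hc2 : 0 < c2) (hc21 : c2 ≤ 1) : ∃ C : ℝ, 0 < C ∧ ∀ (α M : ℝ) (k W : ℕ), 0 ≤ M → 1 ≤ k → 1 ≤ W →
    W ≤ 2 ^ (k + 1) → (∀ d : ℕ, 1 ≤ d → d < W → c2 / W ≤ nint (d * α)) →
    (∀ q ∈ Finset.Ico (2 ^ k) (2 ^ (k + 1)), 0 < nint ((q : ℕ) * α) ∧ 1 / nint ((q : ℕ) * α) ≤ M) →
    (∑ q ∈ Finset.Ico (2 ^ k) (2 ^ (k + 1)), 1 / nint ((q : ℕ) * α)) / (2 ^ k * k) ≤ C * (1 + M / W / k) := by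
  classical
  have hlc : 0 ≤ Real.log (1 / c2) := Real.log_nonneg (by rw [le_div_iff₀ hc2]; linarith)
  refine ⟨6 * (1 / c2 * (3 + Real.log (1 / c2)) + 1), by positivity, ?_⟩
  intro α M k W hM0 hk hW hWk hd hM
  have hk' : (1 : ℝ) ≤ k := by exact_mod_cast hk
  have hW' : (1 : ℝ) ≤ W := by exact_mod_cast hW
  have hWk' : (W : ℝ) ≤ 2 * 2 ^ k := by
    have : (W : ℝ) ≤ 2 ^ (k + 1) := by exact_mod_cast hWk
    rw [pow_succ] at this; linarith
  set σ := c2 / W with hσ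
  have hσ0 : 0 < σ := by positivity
  have hσ1 : σ ≤ 1 := by rw [hσ, div_le_one (by linarith)]; linarith
  set E : ℝ := 2 * M + 2 * ((1 / σ) * (1 + Real.log (1 / σ))) with hE
  set num := 2 ^ k / W + 1 with hnum
  have hmaps : ∀ q ∈ Finset.Ico (2 ^ k) (2 ^ (k + 1)), (q - 2 ^ k) / W ∈ Finset.range num := by
    intro q hq
    rw [Finset.mem_Ico] at hq
    rw [Finset.mem_range, hnum, Nat.lt_succ_iff]
    apply Nat.div_le_div_right
    have : 2 ^ (k + 1) = 2 ^ k + 2 ^ k := by ring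
    omega
  have h1 : ∑ q ∈ Finset.Ico (2 ^ k) (2 ^ (k + 1)), 1 / nint ((q : ℕ) * α) ≤ num * E := by
    rw [← Finset.sum_fiberwise_of_maps_to hmaps]
    calc _ ≤ ∑ i ∈ Finset.range num, E := by
          apply Finset.sum_le_sum
          intro i _
          apply window α σ M hσ0 hσ1 hM0 _ (2 ^ k + i * W) W _ hd
          · intro q hq
            exact hM q (Finset.mem_filter.mp hq).1
          · intro q hq
            rw [Finset.mem_filter, Finset.mem_Ico] at hq
            have h2 := hq.2
            have h3 := Nat.div_mul_le_self (q - 2 ^ k) W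
            have h4 := Nat.lt_div_mul_add (a := q - 2 ^ k) (b := W) (by omega)
            rw [h2] at h3 h4
            omega
      _ = _ := by simp
  have hnum' : (num : ℝ) ≤ 3 * 2 ^ k / W := by
    rw [hnum]; push_cast
    have h2 : ((2 ^ k / W : ℕ) : ℝ) ≤ (2 ^ k : ℕ) / W := Nat.cast_div_le
    push_cast at h2
    have h3 : 1 ≤ 2 * 2 ^ k / (W : ℝ) := by rw [le_div_iff₀ (by linarith)]; linarith
    calc _ ≤ 2 ^ k / (W : ℝ) + 2 * 2 ^ k / W := add_le_add h2 h3
      _ = _ := by ring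
  have hlog : 1 + Real.log (1 / σ) ≤ k * (3 + Real.log (1 / c2)) := by
    have e : 1 / σ = W * (1 / c2) := by rw [hσ]; field_simp
    rw [e, Real.log_mul (by positivity) (by positivity)]
    have h2 : Real.log W ≤ (k + 1) * Real.log 2 := by
      have : (W : ℝ) ≤ 2 ^ (k + 1) := by exact_mod_cast hWk
      calc Real.log W ≤ Real.log (2 ^ (k + 1)) := Real.log_le_log (by positivity) this
        _ = _ := by rw [Real.log_pow]; push_cast; ring
    have h3 := Real.log_two_lt_d9
    have h4 : (k + 1 : ℝ) * Real.log 2 ≤ (k + 1) * 1 := by gcongr; linarith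
    have h5 : Real.log (1 / c2) ≤ k * Real.log (1 / c2) := le_mul_of_one_le_left hlc hk'
    linarith
  have hE0 : 0 ≤ E := by
    have : 0 ≤ Real.log (1 / σ) := Real.log_nonneg (by rw [le_div_iff₀ hσ0]; linarith)
    positivity
  have hEle : E ≤ 2 * M + 2 * (W / c2 * (k * (3 + Real.log (1 / c2)))) := by
    have e : 1 / σ = W / c2 := by rw [hσ]; field_simp
    have h9 : 1 / σ * (1 + Real.log (1 / σ)) ≤ W / c2 * (k * (3 + Real.log (1 / c2))) := by
      calc _ ≤ 1 / σ * (k * (3 + Real.log (1 / c2))) := mul_le_mul_of_nonneg_left hlog (by positivity)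
        _ = _ := by rw [e]
    rw [hE]; linarith
  rw [div_le_iff₀ (by positivity)]
  calc _ ≤ (num : ℝ) * E := h1
    _ ≤ (3 * 2 ^ k / W) * (2 * M + 2 * (W / c2 * (k * (3 + Real.log (1 / c2))))) := by gcongr
    _ = 6 * (M / W / k + 1 / c2 * (3 + Real.log (1 / c2))) * (2 ^ k * k) := by field_simp; norm_num
    _ ≤ _ := by
        apply mul_le_mul_of_nonneg_right _ (by positivity)
        have h6 : 0 ≤ M / W / k := by positivity
        have h7 : 0 ≤ 1 / c2 * (3 + Real.log (1 / c2)) := by positivity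
        nlinarith


end
end Lit

namespace Lit
section
open Set


lemma geo1 (s : Finset ℕ) (X : ℝ) (hX : 0 < X) (h : ∀ k ∈ s, (2 : ℝ) ^ k ≤ X) :
    ∑ k ∈ s, (2 : ℝ) ^ k ≤ 2 * X := by
  rcases s.eq_empty_or_nonempty with rfl | hs
  · simp; linarith
  · have h1 : s ⊆ Finset.range (s.max' hs + 1) := by
      intro k hk
      rw [Finset.mem_range, Nat.lt_succ_iff]
      exact s.le_max' k hk
    have h2 := h _ (s.max'_mem hs)
    calc _ ≤ ∑ k ∈ Finset.range (s.max' hs + 1), (2 : ℝ) ^ k :=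
          Finset.sum_le_sum_of_subset_of_nonneg h1 (fun _ _ _ => by positivity)
      _ = 2 ^ (s.max' hs + 1) - 1 := by
          rw [geom_sum_eq (by norm_num)]; norm_num
      _ ≤ _ := by rw [pow_succ]; linarith

lemma geo2 (s : Finset ℕ) (Y : ℝ) (hY : 0 < Y) (h : ∀ k ∈ s, Y ≤ (2 : ℝ) ^ k) :
    ∑ k ∈ s, 1 / (2 : ℝ) ^ k ≤ 2 / Y := by
  rcases s.eq_empty_or_nonempty with rfl | hs
  · simp; positivity
  · set m := s.min' hs with hm
    have key : ∀ n, ∑ k ∈ Finset.Ico m (m + n), 1 / (2 : ℝ) ^ k = 2 / 2 ^ m - 2 / 2 ^ (m + n) := by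
      intro n
      induction n with
      | zero => simp
      | succ n ih =>
        rw [← add_assoc, Finset.sum_Ico_succ_top (by omega), ih]
        field_simp; ring
    have h1 : s ⊆ Finset.Ico m (m + (s.max' hs + 1)) := by
      intro k hk
      have := s.le_max' k hk
      have := s.min'_le k hk
      rw [Finset.mem_Ico]; omega
    have h2 := h _ (s.min'_mem hs)
    calc _ ≤ ∑ k ∈ Finset.Ico m (m + (s.max' hs + 1)), 1 / (2 : ℝ) ^ k :=
          Finset.sum_le_sum_of_subset_of_nonneg h1 (fun _ _ _ => by positivity)
      _ ≤ 2 / 2 ^ m := by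
          rw [key]
          have : (0 : ℝ) ≤ 2 / 2 ^ (m + (s.max' hs + 1)) := by positivity
          linarith
      _ ≤ _ := by gcongr

section
variable {t : ℝ} {R n0 : ℕ}

lemma c1_pos (P : Par t R n0) : 0 < c1 R := by
  have hR : (16 : ℝ) ≤ R := by exact_mod_cast P.hR
  unfold c1; positivity

lemma alt (P : Par t R n0) (α : ℝ) (V : ℕ → ℚ) (hV : ∀ n, StepProp R n0 n {α} (V n)) (q : ℕ) (hq : 1 ≤ q) :
    c1 R / q ≤ nint (q * α) ∨
      ∃ n, FF n0 n ∧ (V n).den ∣ q ∧ q / (rinv R n0 (n + 1) : ℝ) ≤ nint (q * α) := by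
  have hR := P.hR
  have hq0 : (0 : ℝ) < q := by exact_mod_cast hq
  set w : ℚ := (round ((q : ℝ) * α) : ℚ) / (q : ℚ) with hw
  have hdvd : w.den ∣ q := by
    have := Rat.den_dvd (round ((q : ℝ) * α)) (q : ℤ)
    have h2 : (w.den : ℤ) ∣ (q : ℤ) := by
      rw [hw]; rw [Rat.divInt_eq_div] at this; exact_mod_cast this
    exact_mod_cast h2
  have hden : 1 ≤ w.den := w.den_pos
  have hle : w.den ≤ q := Nat.le_of_dvd hq hdvd
  have heq : nint (q * α) = q * |α - w| := by
    unfold nint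
    have : (q : ℝ) * α - round ((q : ℝ) * α) = q * (α - w) := by
      rw [hw]; push_cast; field_simp
    rw [this, abs_mul, abs_of_pos hq0]
  have ha : 1 ≤ 4 * R * w.den ^ 2 := by
    have : 1 ≤ w.den ^ 2 := Nat.one_le_pow _ _ hden
    nlinarith
  obtain ⟨n, -, h1, h2⟩ := exists_range (R := R) (n0 := n0) (4 * R * w.den ^ 2) (4 * R * w.den ^ 2) ha
    (lt_of_lt_of_le (Nat.lt_pow_self (by omega)) (P.rinv_ge _))
  rcases (hV n).other w ⟨h1, h2⟩ with ⟨hf, h3⟩ | h3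
  · right
    refine ⟨n, hf, h3 ▸ hdvd, ?_⟩
    have := (hV n).dlo hf α rfl
    rw [heq, h3, div_eq_mul_one_div]
    exact mul_le_mul_of_nonneg_left this hq0.le
  · left
    have h4 := h3 α rfl
    have hc := c1_pos P
    have hd0 : (0 : ℝ) < w.den := by exact_mod_cast hden
    have hle' : (w.den : ℝ) ≤ q := by exact_mod_cast hle
    rw [heq]
    calc c1 R / q = q * (c1 R / (q : ℝ) ^ 2) := by field_simp
      _ ≤ q * (c1 R / (w.den : ℝ) ^ 2) := by gcongr
      _ ≤ _ := by gcongr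

lemma Q_mono (P : Par t R n0) (α : ℝ) (V : ℕ → ℚ) (hV : ∀ n, StepProp R n0 n {α} (V n)) {n m : ℕ}
    (hn : FF n0 n) (hm : FF n0 m) (hnm : n < m) : rinv R n0 (n + 1) ≤ 2 * R * (V m).den := by
  have h1 := P.sep hn hm hnm
  have h2 := (hV m).lo hm
  have hR := P.hR
  have h3 : rinv R n0 (n + 1) ^ 2 ≤ (2 * R * (V m).den) ^ 2 := by
    calc _ ≤ 4 * R * (V m).den ^ 2 := h1.trans h2
      _ ≤ 4 * (R * R) * (V m).den ^ 2 := by gcongr; nlinarith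
      _ = _ := by ring
  exact (Nat.pow_le_pow_iff_left (by norm_num)).mp h3

lemma Q_ge (P : Par t R n0) (α : ℝ) (V : ℕ → ℚ) (hV : ∀ n, StepProp R n0 n {α} (V n)) {n : ℕ}
    (hn : FF n0 n) : 2 ^ n ≤ (V n).den := by
  have h2 := (hV n).lo hn
  have h3 := P.rinv_ge n
  have hR := P.hR
  have hn3 : 3 ≤ n := by
    have := hn.1; have := P.hn0; nlinarith
  have h4 : 4 * R * (2 ^ n) ^ 2 ≤ R ^ n := by
    obtain ⟨m, rfl⟩ := Nat.exists_eq_add_of_le hn3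
    have e1 : (4 : ℕ) ^ m ≤ R ^ m := Nat.pow_le_pow_left (by omega) m
    have e2 : (256 : ℕ) ≤ R ^ 2 := by nlinarith
    calc 4 * R * (2 ^ (3 + m)) ^ 2 = 256 * R * 4 ^ m := by
          rw [← pow_mul, mul_comm (3 + m) 2, pow_mul, pow_add]; ring
      _ ≤ R ^ 2 * R * R ^ m := by gcongr
      _ = _ := by ring
  have h5 : (2 ^ n) ^ 2 ≤ (V n).den ^ 2 := by
    have := h4.trans (h3.trans h2)
    exact Nat.le_of_mul_le_mul_left this (by omega)
  exact (Nat.pow_le_pow_iff_left (by norm_num)).mp h5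

lemma nice_pos (P : Par t R n0) (α : ℝ) (V : ℕ → ℚ) (hV : ∀ n, StepProp R n0 n {α} (V n)) (q : ℕ) (hq : 1 ≤ q) :
    0 < nint (q * α) := by
  have hq0 : (0 : ℝ) < q := by exact_mod_cast hq
  rcases alt P α V hV q hq with h | ⟨n, -, -, h⟩
  · exact lt_of_lt_of_le (div_pos (c1_pos P) hq0) h
  · have : (0 : ℝ) < rinv R n0 (n + 1) := by exact_mod_cast P.rinv_pos _
    exact lt_of_lt_of_le (div_pos hq0 this) h

lemma nice_freq (P : Par t R n0) (α : ℝ) (V : ℕ → ℚ) (hV : ∀ n, StepProp R n0 n {α} (V n)) :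
    ∃ᶠ q : ℕ in atTop, q * Real.log q ^ 2 * nint (q * α) ≤ 32768 * R ^ 2 * Real.log R ^ 2 := by
  rw [frequently_atTop]
  intro N
  have hR := P.hR
  have hR' : (16 : ℝ) ≤ R := by exact_mod_cast hR
  set n := 4 ^ (N + n0) with hn
  have hnN : N + n0 < n := Nat.lt_pow_self (by norm_num)
  have hF : FF n0 n := ⟨by omega, _, hn⟩
  have hQ := Q_ge P α V hV hF
  refine ⟨(V n).den, ?_, ?_⟩
  · have : n < 2 ^ n := Nat.lt_two_pow_self
    show N ≤ _
    omega
  set Q := (V n).den with hQdef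
  have hQ1 : 1 ≤ Q := (V n).den_pos
  have hQ0 : (1 : ℝ) ≤ Q := by exact_mod_cast hQ1
  have hn1 : (1 : ℝ) ≤ n := by
    have : 1 ≤ n := by omega
    exact_mod_cast this
  have hhi : (Q : ℝ) ^ 2 ≤ 4 * (32 * R) ^ 2 * rinv R n0 n := by exact_mod_cast (hV n).hi hF
  have hr0 : (0 : ℝ) < rinv R n0 n := by exact_mod_cast P.rinv_pos n
  have hrs : (rinv R n0 (n + 1) : ℝ) = rinv R n0 n * (n : ℝ) ^ 2 := by
    rw [rinv_succ]; unfold ratio; rw [if_pos hF]; push_cast; ring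
  have hnint : nint (Q * α) ≤ Q * (2 / (rinv R n0 (n + 1) : ℝ)) := by
    have h1 := nint_le (Q * α) (V n).num
    have h2 := (hV n).dhi hF α rfl
    have h3 : (Q : ℝ) * α - (V n).num = Q * (α - V n) := by
      rw [mul_sub]; congr 1
      have := Rat.den_mul_eq_num (V n)
      exact_mod_cast this.symm
    rw [h3, abs_mul, abs_of_pos (by linarith)] at h1
    refine h1.trans ?_
    apply mul_le_mul_of_nonneg_left _ (by linarith)
    refine h2.trans ?_
    unfold rr
    rw [mul_one_div]
  have hlog : Real.log Q ≤ 2 * n * Real.log R := by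
    have h1 : (Q : ℝ) ^ 2 ≤ R ^ (4 * n) := by
      have e1 := P.rinv_le' n
      have e3 : 3 ≤ n := by
        have := hF.1; have := P.hn0; nlinarith
      have e2 : 4 * (32 * (R : ℝ)) ^ 2 ≤ R ^ (2 * n) := by
        calc 4 * (32 * (R : ℝ)) ^ 2 = (16 ^ 3) * (R : ℝ) ^ 2 := by ring
          _ ≤ (R : ℝ) ^ 3 * (R : ℝ) ^ 2 := by gcongr
          _ = (R : ℝ) ^ 5 := by ring
          _ ≤ _ := pow_le_pow_right₀ (by linarith) (by omega)
      calc _ ≤ _ := hhi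
        _ ≤ R ^ (2 * n) * R ^ (2 * n) := by gcongr
        _ = _ := by rw [← pow_add]; congr 1; ring
    have h2 := Real.log_le_log (by positivity) h1
    rw [Real.log_pow, Real.log_pow] at h2
    push_cast at h2
    linarith
  have hlog0 : 0 ≤ Real.log Q := Real.log_nonneg hQ0
  calc (Q : ℝ) * Real.log Q ^ 2 * nint (Q * α)
      ≤ Q * (2 * n * Real.log R) ^ 2 * (Q * (2 / (rinv R n0 (n + 1) : ℝ))) := by
        have := nint_nonneg (Q * α)
        gcongr
    _ = Q ^ 2 * (8 * Real.log R ^ 2 / rinv R n0 n) := by rw [hrs]; field_simp; ring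
    _ ≤ (4 * (32 * R) ^ 2 * rinv R n0 n) * (8 * Real.log R ^ 2 / rinv R n0 n) := by gcongr
    _ = _ := by field_simp; ring

end

end
end Lit

namespace Lit
section
open Set


section
variable {t : ℝ} {R n0 : ℕ}

lemma alt' (P : Par t R n0) (α : ℝ) (V : ℕ → ℚ) (hV : ∀ n, StepProp R n0 n {α} (V n)) (q : ℕ) (hq : 1 ≤ q) :
    1 / nint (q * α) ≤ 256 * R ^ 2 * q ∨
      ∃ n, FF n0 n ∧ (V n).den ≤ q ∧ (V n).den ∣ q ∧ 1 / nint (q * α) ≤ rinv R n0 (n + 1) / q := by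
  have hq0 : (0 : ℝ) < q := by exact_mod_cast hq
  have hR' : (16 : ℝ) ≤ R := by exact_mod_cast P.hR
  have hc := c1_pos P
  rcases alt P α V hV q hq with h | ⟨n, h1, h2, h⟩
  · left
    refine (one_div_le_one_div_of_le (by positivity) h).trans (le_of_eq ?_)
    unfold c1; field_simp
  · right
    have : (0 : ℝ) < rinv R n0 (n + 1) := by exact_mod_cast P.rinv_pos _
    refine ⟨n, h1, Nat.le_of_dvd hq h2, h2, ?_⟩
    refine (one_div_le_one_div_of_le (by positivity) h).trans (le_of_eq ?_)
    field_simp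

/-- the scale `k` is affected by the exceptional approximation number `n` -/
def Bad (R n0 : ℕ) (V : ℕ → ℚ) (k n : ℕ) : Prop :=
  FF n0 n ∧ (V n).den < 2 ^ (k + 1) ∧ 4 * R * 2 ^ k * (V n).den < rinv R n0 (n + 1)

lemma bad_facts (P : Par t R n0) (α : ℝ) (V : ℕ → ℚ) (hV : ∀ n, StepProp R n0 n {α} (V n)) {k n : ℕ}
    (hb : Bad R n0 V k n) : n ≤ k ∧ 2 ^ k ≤ n ^ 2 * (V n).den ∧
      rinv R n0 (n + 1) ≤ 4 * R * n ^ 2 * (V n).den ^ 2 := by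
  obtain ⟨hF, h1, h2⟩ := hb
  have hR := P.hR
  have hrs : rinv R n0 (n + 1) = rinv R n0 n * n ^ 2 := by
    rw [rinv_succ]; unfold ratio; rw [if_pos hF]
  have h3 : rinv R n0 (n + 1) ≤ 4 * R * n ^ 2 * (V n).den ^ 2 := by
    rw [hrs]
    calc _ ≤ 4 * R * (V n).den ^ 2 * n ^ 2 := Nat.mul_le_mul_right _ ((hV n).lo hF)
      _ = _ := by ring
  refine ⟨?_, ?_, h3⟩
  · have := (Q_ge P α V hV hF).trans_lt h1
    have := (Nat.pow_lt_pow_iff_right (by norm_num : 1 < 2)).mp this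
    omega
  · have h4 := h2.trans_le h3
    have h5 : (4 * R * (V n).den) * 2 ^ k ≤ (4 * R * (V n).den) * (n ^ 2 * (V n).den) := by
      calc _ = 4 * R * 2 ^ k * (V n).den := by ring
        _ ≤ _ := h4.le
        _ = _ := by ring
    have hd := (V n).den_pos
    exact Nat.le_of_mul_le_mul_left h5 (by positivity)

lemma block_good (P : Par t R n0) (α : ℝ) (V : ℕ → ℚ) (hV : ∀ n, StepProp R n0 n {α} (V n)) (k : ℕ)
    (hb : ∀ n, ¬ Bad R n0 V k n) :
    (∀ d : ℕ, 1 ≤ d → d < 2 ^ k → (1 / (512 * R ^ 2)) / ((2 ^ k : ℕ) : ℝ) ≤ nint (d * α)) ∧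
    (∀ q ∈ Finset.Ico (2 ^ k) (2 ^ (k + 1)), 0 < nint ((q : ℕ) * α) ∧
      1 / nint ((q : ℕ) * α) ≤ 512 * R ^ 2 * 2 ^ k) := by
  have hR' : (16 : ℝ) ≤ R := by exact_mod_cast P.hR
  have key : ∀ d : ℕ, 1 ≤ d → d < 2 ^ (k + 1) → 1 / nint (d * α) ≤ 512 * R ^ 2 * 2 ^ k := by
    intro d hd1 hd2
    have hd0 : (0 : ℝ) < d := by exact_mod_cast hd1
    rcases alt' P α V hV d hd1 with h | ⟨n, h1, h2, -, h⟩
    · refine h.trans ?_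
      have : (d : ℝ) ≤ 2 * 2 ^ k := by
        have : (d : ℝ) ≤ 2 ^ (k + 1) := by exact_mod_cast hd2.le
        rw [pow_succ] at this; linarith
      calc (256 * (R : ℝ) ^ 2 * d) ≤ 256 * (R : ℝ) ^ 2 * (2 * 2 ^ k) := by gcongr
        _ = _ := by ring
    · have h3 : rinv R n0 (n + 1) ≤ 4 * R * 2 ^ k * (V n).den := by
        by_contra hcon
        exact hb n ⟨h1, by omega, by omega⟩
      have h4 : (rinv R n0 (n + 1) : ℝ) ≤ 4 * R * 2 ^ k * d := by
        have := h3.trans (Nat.mul_le_mul_left _ h2)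
        exact_mod_cast this
      refine h.trans ?_
      rw [div_le_iff₀ hd0]
      refine h4.trans ?_
      gcongr
      · norm_num
      · nlinarith
  constructor
  · intro d hd1 hd2
    have hp := nice_pos P α V hV d hd1
    have h := key d hd1 (hd2.trans (Nat.pow_lt_pow_right (by norm_num) (by omega)))
    rw [div_div, one_div_le (by positivity) hp]
    exact_mod_cast h
  · intro q hq
    rw [Finset.mem_Ico] at hq
    have hq1 : 1 ≤ q := le_trans Nat.one_le_two_pow hq.1
    exact ⟨nice_pos P α V hV q hq1, key q hq1 hq.2⟩

lemma block_bad (P : Par t R n0) (α : ℝ) (V : ℕ → ℚ) (hV : ∀ n, StepProp R n0 n {α} (V n)) (k n : ℕ)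
    (hb : Bad R n0 V k n) :
    (∀ d : ℕ, 1 ≤ d → d < (V n).den → (1 / (512 * R ^ 2)) / ((V n).den : ℝ) ≤ nint (d * α)) ∧
    (∀ q ∈ Finset.Ico (2 ^ k) (2 ^ (k + 1)), 0 < nint ((q : ℕ) * α) ∧
      1 / nint ((q : ℕ) * α) ≤ 512 * R ^ 2 * 2 ^ k + rinv R n0 (n + 1) / 2 ^ k) := by
  have hR := P.hR
  have hR' : (16 : ℝ) ≤ R := by exact_mod_cast P.hR
  obtain ⟨hF, hb1, hb2⟩ := hb
  have hQ1 : 1 ≤ (V n).den := (V n).den_pos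
  have hQ0 : (0 : ℝ) < (V n).den := by exact_mod_cast hQ1
  have later : ∀ m, FF n0 m → n < m → 2 ^ (k + 1) ≤ (V m).den ∧ (V n).den ≤ (V m).den := by
    intro m hm hnm
    have h1 := hb2.trans_le (Q_mono P α V hV hF hm hnm)
    have h2 : 2 ^ (k + 1) * (V n).den < (V m).den := by
      have : (2 * R) * (2 ^ (k + 1) * (V n).den) < (2 * R) * (V m).den := by
        calc _ = 4 * R * 2 ^ k * (V n).den := by ring
          _ < _ := h1
      exact Nat.lt_of_mul_lt_mul_left this
    have h3 : 1 ≤ 2 ^ (k + 1) := Nat.one_le_two_pow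
    constructor <;> nlinarith
  constructor
  · intro d hd1 hd2
    have hp := nice_pos P α V hV d hd1
    have hd0 : (1 : ℝ) ≤ d := by exact_mod_cast hd1
    have hdQ : (d : ℝ) ≤ (V n).den := by exact_mod_cast hd2.le
    rw [div_div, one_div_le (by positivity) hp]
    rcases alt' P α V hV d hd1 with h | ⟨m, h1, h2, h3, h⟩
    · refine h.trans ?_
      gcongr
      norm_num
    · rcases lt_trichotomy m n with hmn | rfl | hmn
      · have h4 : (rinv R n0 (m + 1) : ℝ) ≤ 2 * R * (V n).den := by
          exact_mod_cast Q_mono P α V hV h1 hF hmn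
        refine h.trans ((div_le_self (by positivity) hd0).trans (h4.trans ?_))
        gcongr
        · norm_num
        · nlinarith
      · omega
      · have := (later m h1 hmn).2
        omega
  · intro q hq
    rw [Finset.mem_Ico] at hq
    have hq1 : 1 ≤ q := le_trans Nat.one_le_two_pow hq.1
    have hq0 : (0 : ℝ) < q := by exact_mod_cast hq1
    have hq2 : (2 : ℝ) ^ k ≤ q := by exact_mod_cast hq.1
    refine ⟨nice_pos P α V hV q hq1, ?_⟩
    have e0 : 0 ≤ (rinv R n0 (n + 1) : ℝ) / 2 ^ k := by positivity
    have e1 : 0 ≤ 512 * (R : ℝ) ^ 2 * 2 ^ k := by positivity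
    rcases alt' P α V hV q hq1 with h | ⟨m, h1, h2, h3, h⟩
    · have : (q : ℝ) ≤ 2 * 2 ^ k := by
        have : (q : ℝ) ≤ 2 ^ (k + 1) := by exact_mod_cast hq.2.le
        rw [pow_succ] at this; linarith
      have : (256 * (R : ℝ) ^ 2 * q) ≤ 512 * R ^ 2 * 2 ^ k := by
        calc (256 * (R : ℝ) ^ 2 * q) ≤ 256 * (R : ℝ) ^ 2 * (2 * 2 ^ k) := by gcongr
          _ = _ := by ring
      linarith
    · rcases le_or_gt m n with hmn | hmn
      · have h4 : (rinv R n0 (m + 1) : ℝ) ≤ rinv R n0 (n + 1) := by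
          exact_mod_cast P.rinv_mono (by omega : m + 1 ≤ n + 1)
        have : (rinv R n0 (m + 1) : ℝ) / q ≤ rinv R n0 (n + 1) / 2 ^ k := by gcongr
        linarith
      · have := (later m h1 hmn).1
        omega

lemma bad_sum (P : Par t R n0) (α : ℝ) (V : ℕ → ℚ) (hV : ∀ n, StepProp R n0 n {α} (V n)) (n : ℕ) (hn : 1 ≤ n)
    (s : Finset ℕ) (hs : ∀ k ∈ s, Bad R n0 V k n) :
    ∑ k ∈ s, (512 * (R : ℝ) ^ 2 / n) * (2 ^ k / (V n).den + n ^ 2 * (V n).den * (1 / 2 ^ k)) ≤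
      512 * (R : ℝ) ^ 2 * 6 * (n : ℝ) := by
  have hn0 : (0 : ℝ) < n := by exact_mod_cast hn
  have hQ0 : (0 : ℝ) < (V n).den := by exact_mod_cast (V n).den_pos
  rw [← Finset.mul_sum, Finset.sum_add_distrib, ← Finset.sum_div, ← Finset.mul_sum]
  have h1 := geo1 s (n ^ 2 * (V n).den) (by positivity) (fun k hk => by
    exact_mod_cast (bad_facts P α V hV (hs k hk)).2.1)
  have h2 := geo2 s ((V n).den / 2) (by positivity) (fun k hk => by
    have h3 : ((V n).den : ℝ) ≤ 2 ^ (k + 1) := by exact_mod_cast (hs k hk).2.1.le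
    rw [pow_succ] at h3; linarith)
  calc _ ≤ (512 * (R : ℝ) ^ 2 / n) * (2 * (n ^ 2 * (V n).den) / (V n).den + n ^ 2 * (V n).den * (2 / ((V n).den / 2))) := by
        gcongr
    _ = _ := by field_simp; ring

lemma nice_sum (P : Par t R n0) : ∃ C : ℝ, 0 < C ∧ ∀ (α : ℝ) (V : ℕ → ℚ), (∀ n, StepProp R n0 n {α} (V n)) →
    ∀ N : ℕ, ∑ k ∈ Finset.Icc 1 N, (∑ q ∈ Finset.Ico (2 ^ k) (2 ^ (k + 1)), 1 / nint ((q : ℕ) * α)) / (2 ^ k * k)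
      ≤ C * N := by
  classical
  have hR' : (16 : ℝ) ≤ R := by exact_mod_cast P.hR
  obtain ⟨C, hC, hblock⟩ := block (1 / (512 * (R : ℝ) ^ 2)) (by positivity)
    (by rw [div_le_one (by positivity)]; nlinarith)
  set A : ℝ := 512 * R ^ 2 with hA
  have hA0 : 0 < A := by positivity
  refine ⟨C * (1 + A) + C * (A * 16), by positivity, ?_⟩
  intro α V hV N
  rcases Nat.eq_zero_or_pos N with rfl | hN
  · simp
  have hN' : (1 : ℝ) ≤ N := by exact_mod_cast hN
  set D : ℕ → ℕ → ℝ := fun k n => (A / n) * (2 ^ k / (V n).den + n ^ 2 * (V n).den * (1 / 2 ^ k)) with hD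
  have hD0 : ∀ k n, 0 ≤ D k n := by intro k n; simp only [hD]; positivity
  have hk : ∀ k ∈ Finset.Icc 1 N,
      (∑ q ∈ Finset.Ico (2 ^ k) (2 ^ (k + 1)), 1 / nint ((q : ℕ) * α)) / (2 ^ k * k) ≤
      C * (1 + A) + C * ∑ n ∈ (Finset.range (N + 1)).filter (FF n0), if Bad R n0 V k n then D k n else 0 := by
    intro k hk
    rw [Finset.mem_Icc] at hk
    have hk1 : (1 : ℝ) ≤ k := by exact_mod_cast hk.1
    have hk2 : (0 : ℝ) < 2 ^ k := by positivity
    have hsum0 : ∀ n ∈ (Finset.range (N + 1)).filter (FF n0), 0 ≤ if Bad R n0 V k n then D k n else 0 := by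
      intro n _; split_ifs
      · exact hD0 k n
      · exact le_rfl
    by_cases hb : ∃ n, Bad R n0 V k n
    · obtain ⟨n, hb⟩ := hb
      obtain ⟨g1, g2⟩ := block_bad P α V hV k n hb
      obtain ⟨f1, f2, f3⟩ := bad_facts P α V hV hb
      have hn1 : 1 ≤ n := by
        have := hb.1.1; have := P.hn0; have := P.hR; nlinarith
      have hn0' : (0 : ℝ) < n := by exact_mod_cast hn1
      have hQ0 : (0 : ℝ) < (V n).den := by exact_mod_cast (V n).den_pos
      have h := hblock α (A * 2 ^ k + rinv R n0 (n + 1) / 2 ^ k) k (V n).den (by positivity) hk.1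
        (V n).den_pos hb.2.1.le g1 g2
      have h2 : D k n ≤ ∑ n ∈ (Finset.range (N + 1)).filter (FF n0), if Bad R n0 V k n then D k n else 0 := by
        have hmem : n ∈ (Finset.range (N + 1)).filter (FF n0) := by
          rw [Finset.mem_filter, Finset.mem_range]; exact ⟨by omega, hb.1⟩
        have := Finset.single_le_sum hsum0 hmem
        simpa only [hb, if_true] using this
      have h3 : (A * 2 ^ k + rinv R n0 (n + 1) / 2 ^ k) / (V n).den / k ≤ D k n := by
        have f3' : (rinv R n0 (n + 1) : ℝ) ≤ 4 * R * n ^ 2 * (V n).den ^ 2 := by exact_mod_cast f3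
        have f1' : (n : ℝ) ≤ k := by exact_mod_cast f1
        have f4 : 4 * (R : ℝ) ≤ A := by rw [hA]; nlinarith
        calc _ ≤ (A * 2 ^ k + A * n ^ 2 * (V n).den ^ 2 / 2 ^ k) / (V n).den / n := by
              gcongr
              refine f3'.trans ?_
              gcongr
          _ = D k n := by simp only [hD]; field_simp
      refine h.trans ?_
      rw [← mul_add]
      apply mul_le_mul_of_nonneg_left _ hC.le
      linarith
    · push Not at hb
      obtain ⟨g1, g2⟩ := block_good P α V hV k hb
      have h := hblock α (A * 2 ^ k) k (2 ^ k) (by positivity) hk.1 Nat.one_le_two_pow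
        (Nat.pow_le_pow_right (by norm_num) (by omega)) g1 g2
      have h3 : A * 2 ^ k / ((2 ^ k : ℕ) : ℝ) / k ≤ A := by
        push_cast
        rw [mul_div_assoc, div_self hk2.ne', mul_one]
        exact div_le_self hA0.le hk1
      have h4 := Finset.sum_nonneg hsum0
      refine h.trans ?_
      rw [← mul_add]
      apply mul_le_mul_of_nonneg_left _ hC.le
      linarith
  refine (Finset.sum_le_sum hk).trans ?_
  have h5 : ∑ n ∈ (Finset.range (N + 1)).filter (FF n0), ∑ k ∈ Finset.Icc 1 N,
      (if Bad R n0 V k n then D k n else 0) ≤ A * 16 * N := by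
    calc _ ≤ ∑ n ∈ (Finset.range (N + 1)).filter (FF n0), A * 6 * (n : ℝ) := by
          apply Finset.sum_le_sum
          intro n hn
          have hn1 : 1 ≤ n := by
            have := (Finset.mem_filter.mp hn).2.1; have := P.hn0; have := P.hR; nlinarith
          rw [← Finset.sum_filter]
          exact bad_sum P α V hV n hn1 _ (fun k hk => (Finset.mem_filter.mp hk).2)
      _ = A * 6 * ((∑ n ∈ (Finset.range (N + 1)).filter (FF n0), n : ℕ) : ℝ) := by
          rw [← Finset.mul_sum]; push_cast; rfl
      _ ≤ _ := by
          have h6 : (3 : ℝ) * ((∑ n ∈ (Finset.range (N + 1)).filter (FF n0), n : ℕ) : ℝ) ≤ 4 * (N + 1) := by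
            exact_mod_cast sum_FF n0 (N + 1)
          have h7 : ((∑ n ∈ (Finset.range (N + 1)).filter (FF n0), n : ℕ) : ℝ) ≤ 16 / 6 * N := by linarith
          calc _ ≤ A * 6 * (16 / 6 * N) := by gcongr
            _ = _ := by ring
  have h8 : ∑ k ∈ Finset.Icc 1 N, C * (1 + A) = C * (1 + A) * N := by
    simp; ring
  rw [Finset.sum_add_distrib, h8, ← Finset.mul_sum, Finset.sum_comm]
  have := mul_le_mul_of_nonneg_left h5 hC.le
  linarith

lemma nice_of_step (P : Par t R n0) : ∃ C : ℝ, 0 < C ∧ ∀ α, AStep R n0 α → Nice C α := by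
  obtain ⟨C, hC, h⟩ := nice_sum P
  refine ⟨max C (32768 * R ^ 2 * Real.log R ^ 2), lt_max_of_lt_left hC, ?_⟩
  intro α hα
  choose V hV using hα
  refine ⟨fun q hq => nice_pos P α V hV q hq, fun N => (h α V hV N).trans ?_,
    (nice_freq P α V hV).mono fun q hq => hq.trans (le_max_right _ _)⟩
  gcongr
  exact le_max_left _ _

end

end
end Lit

namespace Lit
section
open MeasureTheory Set


def AlphaExists (t : ℝ) : Prop :=
  ∃ C : ℝ, 0 < C ∧ ∃ K0 : ENNReal, K0 ≠ ⊤ ∧ ∀ (U : ℕ → Set ℝ) (ρ : ℕ → ℝ),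
    (∀ i, 0 < ρ i) → (∀ i, ρ i ≤ 1) → (∀ i, ∀ y ∈ U i, ∀ z ∈ U i, |y - z| ≤ ρ i) →
    ∀ v : ℕ → ENNReal, ∃ α, Nice C α ∧
      ∑' i, (U i).indicator (fun _ => v i) α ≤ K0 * ∑' i, v i * ENNReal.ofReal (ρ i ^ t)

def S : Set (ℝ × ℝ) := {pr : ℝ × ℝ |
      0 < atTop.liminf (fun q : ℕ =>
        (q : ℝ) * (Real.log q) ^ 2 * nint (q * pr.1) * nint (q * pr.2))}

lemma mem_S {C α β c : ℝ} (hα : Nice C α) (hc : 0 < c)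
    (h : ∀ᶠ q : ℕ in atTop, c ≤ q * Real.log q ^ 2 * nint (q * α) * nint (q * β)) :
    (α, β) ∈ S := by
  simp only [S, Set.mem_ofPred_eq]
  refine lt_of_lt_of_le hc (Filter.le_liminf_of_le ?_ h)
  apply Filter.IsCoboundedUnder.of_frequently_le (a := C)
  refine hα.freq.mono fun q hq => ?_
  have h1 := nint_le_half ((q : ℝ) * β)
  have h2 := nint_nonneg ((q : ℝ) * β)
  have h3 : 0 ≤ (q : ℝ) * Real.log q ^ 2 * nint (q * α) := mul_nonneg (by positivity) (nint_nonneg _)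
  nlinarith

lemma measure_ne_zero (t : ℝ) (ht0 : 0 < t) (ht1 : t < 1) (hA : AlphaExists t) :
    Measure.hausdorffMeasure (2 * t) S ≠ 0 := by
  obtain ⟨C, hC, K0, hK0, hal⟩ := hA
  obtain ⟨ε, hε, hbe⟩ := beta_exists C t hC ht1
  intro h0
  -- choose δ with K0 * (2 δ) ≤ ε
  obtain ⟨δ, hδ0, hδ⟩ : ∃ δ : ENNReal, 0 < δ ∧ K0 * (δ + δ) ≤ ε := by
    obtain ⟨δ, hδ, hδ2⟩ := ENNReal.exists_pos_mul_lt (a := K0 * 2) (b := ε) (ENNReal.mul_ne_top hK0 (by simp)) hε.ne'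
    refine ⟨δ, hδ, ?_⟩
    rw [← two_mul, ← mul_assoc, mul_comm]; exact hδ2.le
  rw [Measure.hausdorffMeasure_apply] at h0
  have h1 := (iSup_eq_bot.mp h0) 1
  have h2 := (iSup_eq_bot.mp h1) one_pos
  have h3 := lt_of_eq_of_lt h2 hδ0
  simp only [iInf_lt_iff] at h3
  obtain ⟨T, hcov, hdiam, hsum⟩ := h3
  obtain ⟨e, he0, hes⟩ := ENNReal.exists_pos_sum_of_countable hδ0.ne' ℕ
  set d : ℕ → ℝ := fun i => (Metric.ediam (T i)).toReal with hd
  have hnt : ∀ i, Metric.ediam (T i) ≠ ⊤ := fun i => ne_top_of_le_ne_top (by simp) (hdiam i)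
  have hd1 : ∀ i, d i ≤ 1 := fun i => ENNReal.toReal_le_of_le_ofReal zero_le_one (by simpa using hdiam i)
  have hd0 : ∀ i, 0 ≤ d i := fun i => ENNReal.toReal_nonneg
  set g : ℕ → ℝ := fun i => min 1 ((e i : ℝ) ^ (1 / (2 * t))) with hg
  have hg0 : ∀ i, 0 < g i := fun i => lt_min one_pos (Real.rpow_pos_of_pos (he0 i) _)
  set ρ : ℕ → ℝ := fun i => max (d i) (g i) with hρ
  have hρ0 : ∀ i, 0 < ρ i := fun i => lt_of_lt_of_le (hg0 i) (le_max_right _ _)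
  have hρ1 : ∀ i, ρ i ≤ 1 := fun i => max_le (hd1 i) (min_le_left _ _)
  have hdist : ∀ i, ∀ y ∈ T i, ∀ z ∈ T i, dist y z ≤ ρ i := by
    intro i y hy z hz
    refine le_trans ?_ (le_max_left _ _)
    have := Metric.edist_le_ediam_of_mem hy hz
    rw [dist_edist]
    exact ENNReal.toReal_mono (hnt i) this
  have hpow : ∑' i, ENNReal.ofReal (ρ i ^ t) * ENNReal.ofReal (ρ i ^ t) ≤ δ + δ := by
    calc _ ≤ ∑' i, ((⨆ _ : (T i).Nonempty, Metric.ediam (T i) ^ (2 * t)) + (e i : ENNReal)) := by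
          apply ENNReal.tsum_le_tsum
          intro i
          have e1 : ENNReal.ofReal (ρ i ^ t) * ENNReal.ofReal (ρ i ^ t) = ENNReal.ofReal (ρ i ^ (2 * t)) := by
            rw [← ENNReal.ofReal_mul (by have := hρ0 i; positivity), ← Real.rpow_add (hρ0 i)]
            congr 2; ring
          rw [e1]
          have e2 : ρ i = d i ∨ ρ i = g i := max_choice _ _
          rcases e2 with e2 | e2
          · refine le_trans ?_ le_self_add
            rw [e2, ← ENNReal.ofReal_rpow_of_nonneg (hd0 i) (by positivity), hd,
              ENNReal.ofReal_toReal (hnt i)]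
            by_cases hne : (T i).Nonempty
            · simp [hne]
            · rw [Set.not_nonempty_iff_eq_empty] at hne
              have : (0:ℝ) < 2 * t := by positivity
              simp [hne, this]
          · refine le_trans ?_ le_add_self
            rw [e2, ← ENNReal.ofReal_coe_nnreal]
            apply ENNReal.ofReal_le_ofReal
            calc g i ^ (2 * t) ≤ ((e i : ℝ) ^ (1 / (2 * t))) ^ (2 * t) :=
                  Real.rpow_le_rpow (hg0 i).le (min_le_right _ _) (by positivity)
              _ = e i := by
                  rw [← Real.rpow_mul (by positivity)]
                  have : 1 / (2 * t) * (2 * t) = 1 := by field_simp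
                  rw [this, Real.rpow_one]
      _ = _ := ENNReal.tsum_add
      _ ≤ _ := add_le_add hsum.le hes.le
  obtain ⟨α, hα, hαs⟩ := hal (fun i => Prod.fst '' T i) ρ hρ0 hρ1 (by
    rintro i _ ⟨y, hy, rfl⟩ _ ⟨z, hz, rfl⟩
    refine le_trans ?_ (hdist i y hy z hz)
    rw [Prod.dist_eq]
    exact le_max_left _ _) (fun i => ENNReal.ofReal (ρ i ^ t))
  obtain ⟨β, hβ, c, hc, hev⟩ := hbe α hα (fun i => {b | (α, b) ∈ T i}) ρ hρ0 hρ1 (by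
    intro i y hy z hz
    refine le_trans ?_ (hdist i _ hy _ hz)
    rw [Prod.dist_eq]
    exact le_max_right _ _) (by
    refine le_trans ?_ (hαs.trans (le_trans (mul_le_mul_right hpow _) hδ))
    apply ENNReal.tsum_le_tsum
    intro i
    apply iSup_le
    rintro ⟨b, hb⟩
    rw [Set.indicator_of_mem]
    exact ⟨_, hb, rfl⟩)
  have := hcov (mem_S hα hc hev)
  rw [Set.mem_iUnion] at this
  obtain ⟨i, hi⟩ := this
  exact hβ i hi

lemma dimH_S (hA : ∀ t : ℝ, 0 < t → t < 1 → AlphaExists t) : dimH S = 2 := by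
  apply le_antisymm
  · refine (dimH_mono (subset_univ _)).trans ?_
    rw [Real.dimH_univ_eq_finrank]
    simp
  · apply le_of_forall_lt
    intro c hc
    have hct : c ≠ ⊤ := ne_top_of_lt hc
    lift c to NNReal using hct
    have hc2 : (c : ℝ) < 2 := by exact_mod_cast hc
    set t : ℝ := (c / 2 + 1) / 2 with ht
    have hc0 : (0 : ℝ) ≤ c := c.2
    have h := measure_ne_zero t (by positivity) (by linarith) (hA t (by positivity) (by linarith))
    obtain ⟨u, hu⟩ : ∃ u : NNReal, (u : ℝ) = 2 * t := ⟨⟨2 * t, by positivity⟩, rfl⟩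
    rw [← hu] at h
    have h2 : (u : ENNReal) ≤ dimH S := le_dimH_of_hausdorffMeasure_ne_zero h
    refine lt_of_lt_of_le ?_ h2
    rw [ENNReal.coe_lt_coe, ← NNReal.coe_lt_coe]
    rw [hu]
    linarith


end
end Lit

namespace Lit

lemma alpha_exists (t : ℝ) (h0 : 0 < t) (h1 : t < 1) : AlphaExists t := by
  obtain ⟨R, n0, P⟩ := exists_par t h0 h1
  obtain ⟨C, hC, hn⟩ := nice_of_step P
  refine ⟨C, hC, (R : ENNReal), ENNReal.natCast_ne_top R, ?_⟩
  intro U ρ hρ0 hρ1 hU v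
  obtain ⟨α, hα, h⟩ := alpha_tree P U ρ hρ0 hρ1 hU v
  exact ⟨α, hn α hα, h⟩

end Lit

theorem stmt_7 :
    dimH {pr : ℝ × ℝ |
      0 < atTop.liminf (fun q : ℕ =>
        (q : ℝ) * (Real.log q) ^ 2 * nint (q * pr.1) * nint (q * pr.2))} = 2 := by
  exact Lit.dimH_S (fun t h0 h1 => Lit.alpha_exists t h0 h1)
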